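/- Let Γ = (V, E) be a finite simple (loop-free) graph and for each v ∈ V let M_v be a monoid with J(M_v) ≠ {1}, where J(N) = {a ∈ N : ∃ b, c ∈ N, b·a·c = 1}. Then the graph product M = M(Γ, (M_v)_{v∈V}) is context-free if and only if all of the following hold: (1) for each v ∈ V, M_v is context-free; (2) if M_v and M_w are both not FRI-monoids and v ≠ w, then {v,w} ∉ E; (3) if M_v is not an FRI-monoid, M_u and M_w are FRI-monoids, and {v,u}, {v,w} ∈ E with u ≠ w, then {u,w} ∈ E; (4) Γ is chordal. -/

import Mathlib

namespace Paper

/-- `VA M L`: the language `L ⊆ X*` is accepted by a valence automaton over the monoid `M`,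
via the standard characterization: there are a finite alphabet `Y`, a regular language
`R ⊆ Y*`, and monoid homomorphisms `φ : Y* → M`, `h : Y* → X*` with `L = h(R ∩ φ⁻¹(1))`. -/
def VA (M : Type*) [Monoid M] {X : Type} (L : Language X) : Prop :=
  ∃ (Y : Type) (_ : Fintype Y) (R : Language Y)
    (φ : FreeMonoid Y →* M) (h : FreeMonoid Y →* FreeMonoid X),
    R.IsRegular ∧
      L = (fun w => FreeMonoid.toList (h w)) ''
            {w : FreeMonoid Y | FreeMonoid.toList w ∈ R ∧ φ w = 1}

/-- `M` is an FRI-monoid: every finitely generated submonoid `N` of `M` has only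
finitely many right-invertible elements. -/
def IsFRI (M : Type*) [Monoid M] : Prop :=
  ∀ N : Submonoid M, N.FG → {a : N | ∃ b : N, a * b = 1}.Finite

/-- The monoid `M` is context-free: every language in `VA M` (over every finite alphabet)
is context-free. -/
def MonoidContextFree (M : Type*) [Monoid M] : Prop :=
  ∀ (X : Type) (_ : Fintype X) (L : Language X), VA M L → L.IsContextFree

/-- `J(M) = {a ∈ M : ∃ b c, b·a·c = 1}`. -/
def Jset (M : Type*) [Monoid M] : Set M := {a | ∃ b c : M, b * a * c = 1}

/-- Defining relation of the graph product of the monoids `M v` over the simple graph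
with vertex set `V` and adjacency relation `E`: length-two words `(a)(b)` with `a, b`
in the same factor are identified with `(a·b)`, the length-one word `(1)` is identified
with the empty word, and letters from adjacent factors commute. -/
def GraphProdRel (V : Type) (E : V → V → Prop) (M : V → Type) [∀ v, Monoid (M v)] :
    FreeMonoid (Σ v, M v) → FreeMonoid (Σ v, M v) → Prop := fun x y =>
  (∃ (v : V) (a b : M v),
      x = FreeMonoid.of ⟨v, a⟩ * FreeMonoid.of ⟨v, b⟩ ∧ y = FreeMonoid.of ⟨v, a * b⟩) ∨
  (∃ v : V, x = FreeMonoid.of ⟨v, (1 : M v)⟩ ∧ y = 1) ∨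
  (∃ (v w : V) (a : M v) (b : M w), E v w ∧
      x = FreeMonoid.of ⟨v, a⟩ * FreeMonoid.of ⟨w, b⟩ ∧
      y = FreeMonoid.of ⟨w, b⟩ * FreeMonoid.of ⟨v, a⟩)

/-- The graph product `M(Γ, (M_v)_{v ∈ V})`. -/
def GraphProduct (V : Type) (E : V → V → Prop) (M : V → Type) [∀ v, Monoid (M v)] :
    Type :=
  (conGen (GraphProdRel V E M)).Quotient

instance (V : Type) (E : V → V → Prop) (M : V → Type) [∀ v, Monoid (M v)] :
    Monoid (GraphProduct V E M) :=
  inferInstanceAs (Monoid (conGen (GraphProdRel V E M)).Quotient)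

/-- A simple graph is chordal if it has no induced cycle of length at least `4`. -/
def Chordal (V : Type) (E : V → V → Prop) : Prop :=
  ¬ ∃ (n : ℕ) (_ : 4 ≤ n) (c : ZMod n → V), Function.Injective c ∧
      ∀ i j : ZMod n, E (c i) (c j) ↔ (j = i + 1 ∨ i = j + 1)

/-! ### Binary grammars -/

/-- A context-free grammar with binary rules, and finitely many terminal words derivable in one
step from each nonterminal. -/
structure BinGrammar (T : Type) where
  /-- Nonterminals. -/
  NT : Type
  finite : Finite NT
  /-- Binary rules `A → B C`. -/
  bin : NT → NT → NT → Prop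
  /-- Terminal rules `A → w`. -/
  base : NT → List T → Prop
  base_finite : ∀ A, {w | base A w}.Finite

/-- `g.Gen A w`: the nonterminal `A` derives the word `w`. -/
inductive BinGrammar.Gen {T : Type} (g : BinGrammar T) : g.NT → List T → Prop
  | base {A : g.NT} {w : List T} : g.base A w → BinGrammar.Gen g A w
  | bin {A B C : g.NT} {u v : List T} : g.bin A B C → BinGrammar.Gen g B u →
      BinGrammar.Gen g C v → BinGrammar.Gen g A (u ++ v)

section ToContextFree

variable {T : Type} (g : BinGrammar T)

/-- The rules of the context-free grammar attached to a binary grammar. -/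
def BinGrammar.rules : Set (ContextFreeRule T g.NT) :=
  {r | (∃ A B C, g.bin A B C ∧ r = ⟨A, [.nonterminal B, .nonterminal C]⟩) ∨
    ∃ A w, g.base A w ∧ r = ⟨A, w.map .terminal⟩}

lemma BinGrammar.rules_finite : g.rules.Finite := by
  have := g.finite
  refine Set.Finite.union ?_ ?_
  · refine (Set.finite_range (fun p : g.NT × g.NT × g.NT =>
      (⟨p.1, [.nonterminal p.2.1, .nonterminal p.2.2]⟩ : ContextFreeRule T g.NT))).subset ?_
    rintro _ ⟨A, B, C, -, rfl⟩
    exact ⟨(A, B, C), rfl⟩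
  · refine (Set.finite_iUnion (fun A => (g.base_finite A).image
      (fun w => (⟨A, w.map .terminal⟩ : ContextFreeRule T g.NT)))).subset ?_
    rintro _ ⟨A, w, h, rfl⟩
    exact Set.mem_iUnion.2 ⟨A, w, h, rfl⟩

/-- The context-free grammar attached to a binary grammar. -/
noncomputable def BinGrammar.toCFG (S : g.NT) : ContextFreeGrammar T :=
  ⟨g.NT, S, g.rules_finite.toFinset⟩

/-- `g.Yields s w`: the sentential form `s` derives the terminal word `w`. -/
inductive BinGrammar.Yields : List (Symbol T g.NT) → List T → Prop
  | nil : BinGrammar.Yields [] []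
  | terminal {s w} (t : T) : BinGrammar.Yields s w → BinGrammar.Yields (.terminal t :: s) (t :: w)
  | nonterminal {A u s w} : g.Gen A u → BinGrammar.Yields s w →
      BinGrammar.Yields (.nonterminal A :: s) (u ++ w)

variable {g}

lemma BinGrammar.Gen.derives (S : g.NT) {A : g.NT} {w : List T} (h : g.Gen A w) :
    (g.toCFG S).Derives [.nonterminal A] (w.map .terminal) := by
  induction h with
  | @base A w h =>
    refine ContextFreeGrammar.Produces.single ⟨⟨A, w.map .terminal⟩, ?_, ?_⟩
    · exact g.rules_finite.mem_toFinset.2 (Or.inr ⟨A, w, h, rfl⟩)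
    · exact ContextFreeRule.Rewrites.input_output
  | @bin A B C u v h _ _ ihu ihv =>
    refine ContextFreeGrammar.Produces.trans_derives
      (v := [.nonterminal B] ++ [.nonterminal C])
      ⟨⟨A, [.nonterminal B, .nonterminal C]⟩, ?_, ?_⟩ ?_
    · exact g.rules_finite.mem_toFinset.2 (Or.inl ⟨A, B, C, h, rfl⟩)
    · exact ContextFreeRule.Rewrites.input_output
    · rw [List.map_append]
      exact (ihu.append_right _).trans (ihv.append_left _)

lemma BinGrammar.Yields.append {s s' : List (Symbol T g.NT)} {w w' : List T}
    (h : g.Yields s w) (h' : g.Yields s' w') : g.Yields (s ++ s') (w ++ w') := by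
  induction h with
  | nil => exact h'
  | terminal t _ ih => exact ih.terminal t
  | nonterminal hA _ ih => simpa using BinGrammar.Yields.nonterminal hA ih

lemma BinGrammar.Yields.split {s s' : List (Symbol T g.NT)} {w : List T}
    (h : g.Yields (s ++ s') w) : ∃ u v, g.Yields s u ∧ g.Yields s' v ∧ w = u ++ v := by
  induction s generalizing w with
  | nil => exact ⟨[], w, .nil, h, rfl⟩
  | cons X s ih =>
    cases h with
    | terminal t h =>
      obtain ⟨u, v, hu, hv, rfl⟩ := ih h
      exact ⟨t :: u, v, hu.terminal t, hv, rfl⟩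
    | nonterminal hA h =>
      obtain ⟨u, v, hu, hv, rfl⟩ := ih h
      exact ⟨_, v, hu.nonterminal hA, hv, by simp⟩

lemma BinGrammar.yields_terminals (w : List T) : g.Yields (w.map .terminal) w := by
  induction w with
  | nil => exact .nil
  | cons t w ih => exact ih.terminal t

lemma BinGrammar.Yields.eq_of_terminals {w w' : List T} (h : g.Yields (w.map .terminal) w') :
    w' = w := by
  induction w generalizing w' with
  | nil => cases h; rfl
  | cons t w ih => cases h with
    | terminal t h => rw [ih h]

lemma BinGrammar.Gen.yields {A : g.NT} {w : List T} (h : g.Gen A w) :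
    g.Yields [.nonterminal A] w := by
  simpa using BinGrammar.Yields.nonterminal h .nil

lemma BinGrammar.Yields.gen {A : g.NT} {w : List T} (h : g.Yields [.nonterminal A] w) :
    g.Gen A w := by
  cases h with
  | nonterminal hA h => cases h; simpa using hA

lemma BinGrammar.Yields.of_rule {r : ContextFreeRule T g.NT} (hr : r ∈ g.rules) {w : List T}
    (h : g.Yields r.output w) : g.Gen r.input w := by
  obtain ⟨A, B, C, hb, rfl⟩ | ⟨A, w', hb, rfl⟩ := hr
  · obtain ⟨u, v, hu, hv, rfl⟩ := h.split (s := [.nonterminal B])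
    exact .bin hb hu.gen hv.gen
  · rw [h.eq_of_terminals]
    exact .base hb

lemma BinGrammar.yields_of_derives (S : g.NT) {s : List (Symbol T g.NT)} {w : List T}
    (h : (g.toCFG S).Derives s (w.map .terminal)) : g.Yields s w := by
  induction h using Relation.ReflTransGen.head_induction_on with
  | refl => exact yields_terminals w
  | head hp _ ih =>
    obtain ⟨r, hr, hrw⟩ := hp
    obtain ⟨p, q, rfl, rfl⟩ := hrw.exists_parts
    obtain ⟨u, v, hu, hv, rfl⟩ := ih.split
    obtain ⟨u₁, u₂, hu₁, hu₂, rfl⟩ := hu.split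
    exact (hu₁.append (hu₂.of_rule (g.rules_finite.mem_toFinset.1 hr)).yields).append hv

theorem BinGrammar.isContextFree (g : BinGrammar T) (S : g.NT) :
    Language.IsContextFree ({w | g.Gen S w} : Language T) := by
  refine ⟨g.toCFG S, ?_⟩
  ext w
  rw [ContextFreeGrammar.mem_language_iff]
  exact ⟨fun h => (yields_of_derives S h).gen, fun h => h.derives S⟩

end ToContextFree

section OfContextFree

variable {T : Type} (g : ContextFreeGrammar T)

/-- Parse trees of a context-free grammar, read on sentential forms. -/
inductive Parse : List (Symbol T g.NT) → List T → Prop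
  | nil : Parse [] []
  | terminal (t : T) : Parse [.terminal t] [t]
  | cons {X s u w} : Parse [X] u → Parse s w → Parse (X :: s) (u ++ w)
  | rule {r u} : r ∈ g.rules → Parse r.output u → Parse [.nonterminal r.input] u

variable {g}

lemma Parse.cons_inv {X : Symbol T g.NT} {s : List (Symbol T g.NT)} {w : List T}
    (h : Parse g (X :: s) w) : ∃ u v, Parse g [X] u ∧ Parse g s v ∧ w = u ++ v := by
  cases h with
  | terminal t => exact ⟨[t], [], .terminal t, .nil, rfl⟩
  | cons h1 h2 => exact ⟨_, _, h1, h2, rfl⟩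
  | rule hr h => exact ⟨w, [], .rule hr h, .nil, by simp⟩

lemma Parse.append {s s' : List (Symbol T g.NT)} {w w' : List T}
    (h : Parse g s w) (h' : Parse g s' w') : Parse g (s ++ s') (w ++ w') := by
  induction s generalizing w with
  | nil => cases h; exact h'
  | cons X s ih =>
    obtain ⟨u, v, hu, hv, rfl⟩ := h.cons_inv
    simpa using Parse.cons hu (ih hv)

lemma Parse.split {s s' : List (Symbol T g.NT)} {w : List T}
    (h : Parse g (s ++ s') w) : ∃ u v, Parse g s u ∧ Parse g s' v ∧ w = u ++ v := by
  induction s generalizing w with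
  | nil => exact ⟨[], w, .nil, h, rfl⟩
  | cons X s ih =>
    obtain ⟨u, v, hu, hv, rfl⟩ := Parse.cons_inv h
    obtain ⟨u', v', hu', hv', rfl⟩ := ih hv
    exact ⟨u ++ u', v', .cons hu hu', hv', by simp⟩

lemma Parse.of_derives {s : List (Symbol T g.NT)} {w : List T}
    (h : g.Derives s (w.map .terminal)) : Parse g s w := by
  induction h using Relation.ReflTransGen.head_induction_on with
  | refl =>
    induction w with
    | nil => exact .nil
    | cons t w ih => exact Parse.cons (.terminal t) ih
  | head hp _ ih =>
    obtain ⟨r, hr, hrw⟩ := hp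
    obtain ⟨p, q, rfl, rfl⟩ := hrw.exists_parts
    obtain ⟨u, v, hu, hv, rfl⟩ := ih.split
    obtain ⟨u₁, u₂, hu₁, hu₂, rfl⟩ := hu.split
    exact (hu₁.append (hu₂.rule hr)).append hv

lemma Parse.derives {s : List (Symbol T g.NT)} {w : List T}
    (h : Parse g s w) : g.Derives s (w.map .terminal) := by
  induction h with
  | nil => exact .refl _
  | terminal t => exact .refl _
  | @cons X s u w _ _ ih1 ih2 =>
    rw [List.map_append]
    exact (ih1.append_right s).trans (ih2.append_left _)
  | rule hr _ ih =>
    exact ContextFreeGrammar.Produces.trans_derives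
      ⟨_, hr, ContextFreeRule.Rewrites.input_output⟩ ih

variable (g)

/-- The sentential forms that occur as nonterminals of the binarization. -/
def sententialForms : Set (List (Symbol T g.NT)) :=
  {[.nonterminal g.initial], []} ∪
    ⋃ r ∈ g.rules, ({s | s ∈ r.output.tails} ∪ (fun X => [X]) '' {X | X ∈ r.output})

lemma sententialForms_finite : (sententialForms g).Finite := by
  refine (Set.toFinite _).union (g.rules.finite_toSet.biUnion fun r _ => ?_)
  exact (List.finite_toSet _).union ((List.finite_toSet _).image _)

lemma sententialForms_cons {X : Symbol T g.NT} {s : List (Symbol T g.NT)}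
    (h : X :: s ∈ sententialForms g) : [X] ∈ sententialForms g ∧ s ∈ sententialForms g := by
  have hnil : [] ∈ sententialForms g := by simp [sententialForms]
  obtain h | h := h
  · obtain h | h := h
    · obtain ⟨rfl, rfl⟩ := List.cons.inj h
      exact ⟨Or.inl (Or.inl rfl), hnil⟩
    · simp at h
  · simp only [Set.mem_iUnion] at h
    obtain ⟨r, hr, h | ⟨Y, hY, h⟩⟩ := h
    · have h' : X :: s <:+ r.output := by simpa using h
      constructor
      · refine Or.inr (Set.mem_iUnion₂.2 ⟨r, hr, Or.inr ⟨X, ?_, rfl⟩⟩)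
        exact h'.subset (by simp)
      · refine Or.inr (Set.mem_iUnion₂.2 ⟨r, hr, Or.inl ?_⟩)
        simpa using (List.suffix_cons X s).trans h'
    · obtain ⟨rfl, rfl⟩ := List.cons.inj h
      exact ⟨Or.inr (Set.mem_iUnion₂.2 ⟨r, hr, Or.inr ⟨Y, hY, rfl⟩⟩), hnil⟩

lemma sententialForms_output {r : ContextFreeRule T g.NT} (h : r ∈ g.rules) :
    r.output ∈ sententialForms g :=
  Or.inr (Set.mem_iUnion₂.2 ⟨r, h, Or.inl (by simp)⟩)

/-- The binarization of a context-free grammar. -/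
def binarization : BinGrammar T where
  NT := sententialForms g
  finite := (sententialForms_finite g)
  bin a b c := (∃ X s, a.1 = X :: s ∧ b.1 = [X] ∧ c.1 = s) ∨
    ∃ r ∈ g.rules, a.1 = [.nonterminal r.input] ∧ b.1 = r.output ∧ c.1 = []
  base a w := (a.1 = [] ∧ w = []) ∨ ∃ t, a.1 = [.terminal t] ∧ w = [t]
  base_finite := by
    rintro ⟨a, ha⟩
    refine Set.Subsingleton.finite ?_
    rintro w (⟨h1, h2⟩ | ⟨t, h1, h2⟩) w' (⟨h1', h2'⟩ | ⟨t', h1', h2'⟩) <;> simp_all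

lemma binarization_parse {a : (binarization g).NT} {w : List T}
    (h : (binarization g).Gen a w) : Parse g (Subtype.val (p := (· ∈ sententialForms g)) a) w := by
  induction h with
  | base h =>
    obtain ⟨h, rfl⟩ | ⟨t, h, rfl⟩ := h
    · rw [h]; exact .nil
    · rw [h]; exact .terminal t
  | bin h _ _ ih1 ih2 =>
    obtain ⟨X, s, h1, h2, h3⟩ | ⟨r, hr, h1, h2, h3⟩ := h
    · rw [h1]; rw [h2] at ih1; rw [h3] at ih2; exact .cons ih1 ih2
    · rw [h1]; rw [h2] at ih1; rw [h3] at ih2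
      cases ih2
      simpa using Parse.rule hr ih1

lemma binarization_gen_iff (a : sententialForms g) (w : List T) :
    (binarization g).Gen a w ↔ Parse g a.1 w := by
  constructor
  · exact binarization_parse g
  · obtain ⟨s, hs⟩ := a
    intro h
    change Parse g s w at h
    induction h with
    | nil => exact .base (Or.inl ⟨rfl, rfl⟩)
    | terminal t => exact .base (Or.inr ⟨t, rfl, rfl⟩)
    | cons _ _ ih1 ih2 =>
      have := sententialForms_cons g hs
      exact .bin (Or.inl ⟨_, _, rfl, rfl, rfl⟩) (ih1 this.1) (ih2 this.2)
    | @rule r u hr _ ih =>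
      have hnil : [] ∈ sententialForms g := by simp [sententialForms]
      have := BinGrammar.Gen.bin (g := binarization g) (A := ⟨_, hs⟩) (C := ⟨[], hnil⟩)
        (Or.inr ⟨r, hr, rfl, rfl, rfl⟩) (ih (sententialForms_output g hr))
        (.base (Or.inl ⟨rfl, rfl⟩))
      simpa using this

end OfContextFree

/-- Every context-free language is generated by a binary grammar in which all terminal rules
produce words of length at most one. -/
theorem exists_binGrammar {T : Type} {L : Language T} (h : L.IsContextFree) :
    ∃ (g : BinGrammar T) (S : g.NT), (∀ A w, g.base A w → w.length ≤ 1) ∧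
      ∀ w, w ∈ L ↔ g.Gen S w := by
  obtain ⟨g, rfl⟩ := h
  refine ⟨binarization g, ⟨[.nonterminal g.initial], by simp [sententialForms]⟩, ?_, ?_⟩
  · rintro A w (⟨-, rfl⟩ | ⟨t, -, rfl⟩) <;> simp
  · intro w
    rw [ContextFreeGrammar.mem_language_iff]
    exact ⟨fun h => (binarization_gen_iff g _ w).2 (Parse.of_derives h),
      fun h => ((binarization_gen_iff g _ w).1 h).derives⟩

/-! ### Closure properties of context-free languages -/

/-- The language `{w | p w}` is context-free. -/
def CF {T : Type} (p : List T → Prop) : Prop := Language.IsContextFree ({w | p w} : Language T)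

lemma CF.congr {T : Type} {p q : List T → Prop} (h : CF p) (hpq : ∀ w, q w ↔ p w) : CF q := by
  have : q = p := by ext w; exact hpq w
  rwa [this]

lemma BinGrammar.cf {T : Type} {p : List T → Prop} (g : BinGrammar T) (S : g.NT)
    (h : ∀ w, p w ↔ g.Gen S w) : CF p :=
  CF.congr (g.isContextFree S) h

lemma CF.exists_grammar {T : Type} {p : List T → Prop} (h : CF p) :
    ∃ (g : BinGrammar T) (S : g.NT), (∀ A w, g.base A w → w.length ≤ 1) ∧
      ∀ w, p w ↔ g.Gen S w :=
  exists_binGrammar h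

/-- Image of a grammar under a homomorphism of free monoids. -/
def BinGrammar.subst {T T' : Type} (g : BinGrammar T) (h : T → List T') : BinGrammar T' where
  NT := g.NT
  finite := g.finite
  bin := g.bin
  base A w := ∃ u, g.base A u ∧ w = u.flatMap h
  base_finite A := by
    refine ((g.base_finite A).image (fun u => u.flatMap h)).subset ?_
    rintro _ ⟨u, hu, rfl⟩
    exact ⟨u, hu, rfl⟩

theorem CF.flatMap {T T' : Type} {p : List T → Prop} (hp : CF p) (h : T → List T') :
    CF fun w : List T' => ∃ u, p u ∧ u.flatMap h = w := by
  obtain ⟨g, S, -, hg⟩ := hp.exists_grammar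
  refine (g.subst h).cf S fun w => ⟨?_, fun hw => ?_⟩
  · rintro ⟨u, hu, rfl⟩
    have := (hg u).1 hu
    clear hu hg
    induction this with
    | @base A w hb => exact BinGrammar.Gen.base (g := g.subst h) (A := A) ⟨_, hb, rfl⟩
    | bin hb _ _ ih1 ih2 =>
      rw [List.flatMap_append]
      exact .bin (g := g.subst h) hb ih1 ih2
  · have key : ∀ (A : (g.subst h).NT) (w : List T'), (g.subst h).Gen A w →
        ∃ u, BinGrammar.Gen g A u ∧ u.flatMap h = w := by
      intro A w hw
      induction hw with
      | base hb =>
        obtain ⟨u, hu, rfl⟩ := hb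
        exact ⟨u, .base hu, rfl⟩
      | bin hb _ _ ih1 ih2 =>
        obtain ⟨u, hu, rfl⟩ := ih1
        obtain ⟨v, hv, rfl⟩ := ih2
        exact ⟨u ++ v, .bin hb hu hv, List.flatMap_append⟩
    obtain ⟨u, hu, rfl⟩ := key _ _ hw
    exact ⟨u, (hg u).2 hu, rfl⟩

/-- `Path step p w q`: the automaton with transition relation `step` can go from `p` to `q`
reading `w`. -/
inductive Path {Q T : Type} (step : Q → T → Q → Prop) : Q → List T → Q → Prop
  | nil (p : Q) : Path step p [] p
  | cons {p q r : Q} {t : T} {w : List T} : step p t q → Path step q w r → Path step p (t :: w) r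

lemma Path.append {Q T : Type} {step : Q → T → Q → Prop} {p q r : Q} {u v : List T}
    (h : Path step p u q) (h' : Path step q v r) : Path step p (u ++ v) r := by
  induction h with
  | nil => exact h'
  | cons hs _ ih => exact .cons hs (ih h')

lemma Path.split {Q T : Type} {step : Q → T → Q → Prop} {p r : Q} {u v : List T}
    (h : Path step p (u ++ v) r) : ∃ q, Path step p u q ∧ Path step q v r := by
  induction u generalizing p with
  | nil => exact ⟨p, .nil p, h⟩
  | cons t u ih =>
    cases h with
    | cons hs h =>
      obtain ⟨q, h1, h2⟩ := ih h
      exact ⟨q, .cons hs h1, h2⟩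

/-- Product of a grammar and an automaton. -/
def BinGrammar.inter {T Q : Type} [Finite Q] (g : BinGrammar T) (step : Q → T → Q → Prop) :
    BinGrammar T where
  NT := Q × g.NT × Q
  finite := by have := g.finite; infer_instance
  bin A B C := g.bin A.2.1 B.2.1 C.2.1 ∧ A.1 = B.1 ∧ B.2.2 = C.1 ∧ C.2.2 = A.2.2
  base A w := g.base A.2.1 w ∧ Path step A.1 w A.2.2
  base_finite A := (g.base_finite A.2.1).subset fun _ h => h.1

theorem CF.inter {T Q : Type} [Finite Q] {p : List T → Prop} (hp : CF p)
    (step : Q → T → Q → Prop) (a b : Q) : CF fun w => p w ∧ Path step a w b := by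
  obtain ⟨g, S, -, hg⟩ := hp.exists_grammar
  refine (g.inter step).cf (a, S, b) fun w => ⟨?_, fun hw => ?_⟩
  · rintro ⟨hw, hpath⟩
    have := (hg w).1 hw
    clear hg hw
    induction this generalizing a b with
    | base hb => exact .base ⟨hb, hpath⟩
    | @bin A B C u v hb _ _ ih1 ih2 =>
      obtain ⟨q, h1, h2⟩ := hpath.split
      exact BinGrammar.Gen.bin (g := g.inter step) (A := (a, A, b)) (B := (a, B, q))
        (C := (q, C, b)) ⟨hb, rfl, rfl, rfl⟩ (ih1 _ _ h1) (ih2 _ _ h2)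
  · suffices ∀ A w, (g.inter step).Gen A w → g.Gen A.2.1 w ∧ Path step A.1 w A.2.2 by
      have := this _ _ hw
      exact ⟨(hg w).2 this.1, this.2⟩
    intro A w hw
    induction hw with
    | base hb => exact ⟨.base hb.1, hb.2⟩
    | bin hb _ _ ih1 ih2 =>
      obtain ⟨h1, h2, h3, h4⟩ := hb
      refine ⟨.bin h1 ih1.1 ih2.1, ?_⟩
      rw [h2, ← h4]
      refine ih1.2.append ?_
      rw [h3]
      exact ih2.2

/-- Letterwise substitution: `Subst L α w` when `w` arises from `α` by replacing every letter
`inr j` by a word obtained recursively from a word satisfying `L j`. -/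
inductive Subst {T I : Type} (L : I → List (T ⊕ I) → Prop) : List (T ⊕ I) → List T → Prop
  | nil : Subst L [] []
  | term {α w} (t : T) : Subst L α w → Subst L (Sum.inl t :: α) (t :: w)
  | nonterm {j β u α w} : L j β → Subst L β u → Subst L α w → Subst L (Sum.inr j :: α) (u ++ w)

/-- The grammar of the iterated substitution of a finite family of context-free languages. -/
def iterGrammar {T I : Type} [Finite I] (g : I → BinGrammar (T ⊕ I)) (S : ∀ i, (g i).NT) :
    BinGrammar T where
  NT := Option (Σ i, (g i).NT)
  finite := by have := fun i => (g i).finite; infer_instance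
  bin a b c := ∃ (i : I) (A : (g i).NT), a = some ⟨i, A⟩ ∧
    ((∃ B C, (g i).bin A B C ∧ b = some ⟨i, B⟩ ∧ c = some ⟨i, C⟩) ∨
      ∃ j, (g i).base A [Sum.inr j] ∧ b = some ⟨j, S j⟩ ∧ c = none)
  base a w := (a = none ∧ w = []) ∨ ∃ (i : I) (A : (g i).NT), a = some ⟨i, A⟩ ∧
    (g i).base A (w.map Sum.inl)
  base_finite a := by
    rcases a with _ | ⟨i, A⟩
    · refine (Set.finite_singleton []).subset ?_
      rintro w (⟨-, h⟩ | ⟨i, A, h, -⟩)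
      · exact h
      · cases h
    · refine (((g i).base_finite A).preimage
        (f := List.map Sum.inl) (Sum.inl_injective.list_map.injOn)).subset ?_
      rintro w (⟨h, -⟩ | ⟨i, A, h, h'⟩)
      · cases h
      · cases h; exact h'

lemma Subst.append {T I : Type} {L : I → List (T ⊕ I) → Prop} {α β : List (T ⊕ I)}
    {u v : List T} (h : Subst L α u) (h' : Subst L β v) : Subst L (α ++ β) (u ++ v) := by
  induction h with
  | nil => exact h'
  | term t _ ih => exact ih.term t
  | nonterm hL hβ _ _ ih => simpa using Subst.nonterm hL hβ ih

lemma Subst.of_map_inl {T I : Type} {L : I → List (T ⊕ I) → Prop} (w : List T) :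
    Subst L (w.map Sum.inl) w := by
  induction w with
  | nil => exact .nil
  | cons t w ih => exact ih.term t

lemma Subst.split {T I : Type} {L : I → List (T ⊕ I) → Prop} {α β : List (T ⊕ I)}
    {w : List T} (h : Subst L (α ++ β) w) : ∃ u v, Subst L α u ∧ Subst L β v ∧ w = u ++ v := by
  induction α generalizing w with
  | nil => exact ⟨[], w, .nil, h, rfl⟩
  | cons x α ih =>
    cases h with
    | term t h =>
      obtain ⟨u, v, hu, hv, rfl⟩ := ih h
      exact ⟨t :: u, v, hu.term t, hv, rfl⟩
    | nonterm hL hβ h =>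
      obtain ⟨u, v, hu, hv, rfl⟩ := ih h
      exact ⟨_, v, Subst.nonterm hL hβ hu, hv, by simp⟩

section Iter

variable {T I : Type} [Finite I] (g : I → BinGrammar (T ⊕ I)) (S : ∀ i, (g i).NT)

/-- Letterwise expansion of the letters `inr j` by words derived in the iterated grammar. -/
inductive Expand : List (T ⊕ I) → List T → Prop
  | nil : Expand [] []
  | term {α w} (t : T) : Expand α w → Expand (Sum.inl t :: α) (t :: w)
  | nonterm {j u α w} : (iterGrammar g S).Gen (some ⟨j, S j⟩) u → Expand α w →
      Expand (Sum.inr j :: α) (u ++ w)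

variable {g S}

lemma Expand.split {α β : List (T ⊕ I)} {w : List T} (h : Expand g S (α ++ β) w) :
    ∃ u v, Expand g S α u ∧ Expand g S β v ∧ w = u ++ v := by
  induction α generalizing w with
  | nil => exact ⟨[], w, .nil, h, rfl⟩
  | cons x α ih =>
    cases h with
    | term t h =>
      obtain ⟨u, v, hu, hv, rfl⟩ := ih h
      exact ⟨t :: u, v, hu.term t, hv, rfl⟩
    | nonterm hL h =>
      obtain ⟨u, v, hu, hv, rfl⟩ := ih h
      exact ⟨_, v, hu.nonterm hL, hv, by simp⟩

lemma Expand.gen (hlen : ∀ i A w, (g i).base A w → w.length ≤ 1) {i : I} {A : (g i).NT}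
    {α : List (T ⊕ I)} (hA : (g i).Gen A α) {w : List T} (h : Expand g S α w) :
    (iterGrammar g S).Gen (some ⟨i, A⟩) w := by
  induction hA generalizing w with
  | @base A α hb =>
    have := hlen _ _ _ hb
    rcases h with _ | ⟨t, h⟩ | ⟨hj, h⟩
    · exact .base (Or.inr ⟨i, A, rfl, hb⟩)
    · obtain rfl : _ = [] := List.length_eq_zero_iff.1 (by simpa using this)
      cases h
      exact .base (Or.inr ⟨i, A, rfl, hb⟩)
    · obtain rfl : _ = [] := List.length_eq_zero_iff.1 (by simpa using this)
      cases h
      exact .bin (g := iterGrammar g S) ⟨i, A, rfl, Or.inr ⟨_, hb, rfl, rfl⟩⟩ hj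
        (.base (Or.inl ⟨rfl, rfl⟩))
  | bin hb _ _ ih1 ih2 =>
    obtain ⟨u, v, hu, hv, rfl⟩ := h.split
    exact .bin (g := iterGrammar g S) ⟨i, _, rfl, Or.inl ⟨_, _, hb, rfl, rfl⟩⟩ (ih1 hu) (ih2 hv)

end Iter

theorem CF.iterate {T I : Type} [Finite I] {L : I → List (T ⊕ I) → Prop} (hL : ∀ i, CF (L i))
    (i : I) : CF fun w => ∃ α, L i α ∧ Subst L α w := by
  choose g S hlen hg using fun i => (hL i).exists_grammar
  have key : ∀ {α w}, Subst L α w → Expand g S α w := by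
    intro α w h
    induction h with
    | nil => exact .nil
    | term t _ ih => exact ih.term t
    | nonterm hj _ _ ih1 ih2 => exact ih2.nonterm (ih1.gen hlen ((hg _ _).1 hj))
  refine (iterGrammar g S).cf (some ⟨i, S i⟩) fun w => ⟨?_, fun hw => ?_⟩
  · rintro ⟨α, hα, h⟩
    exact (key h).gen hlen ((hg _ _).1 hα)
  · suffices ∀ a w, (iterGrammar g S).Gen a w →
        (a = none ∧ w = []) ∨ ∃ (i : I) (A : (g i).NT) (α : List (T ⊕ I)), a = some ⟨i, A⟩ ∧
          (g i).Gen A α ∧ Subst L α w by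
      obtain ⟨h, -⟩ | ⟨j, A, α, h, hα, hs⟩ := this _ _ hw
      · cases h
      · cases h
        exact ⟨α, (hg _ _).2 hα, hs⟩
    clear hw w
    intro a w hw
    induction hw with
    | base hb =>
      obtain h | ⟨i, A, rfl, hb⟩ := hb
      · exact Or.inl h
      · exact Or.inr ⟨i, A, _, rfl, .base hb, .of_map_inl _⟩
    | bin hb _ _ ih1 ih2 =>
      obtain ⟨i, A, rfl, ⟨B, C, hb, rfl, rfl⟩ | ⟨j, hb, rfl, rfl⟩⟩ := hb
      · obtain ⟨h, -⟩ | ⟨i1, B1, α, h1, hα, hs⟩ := ih1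
        · cases h
        obtain ⟨h, -⟩ | ⟨i2, C1, β, h2, hβ, hs'⟩ := ih2
        · cases h
        cases h1
        cases h2
        exact Or.inr ⟨i, A, α ++ β, rfl, .bin hb hα hβ, hs.append hs'⟩
      · obtain ⟨h, -⟩ | ⟨i1, B1, α, h1, hα, hs⟩ := ih1
        · cases h
        obtain ⟨-, rfl⟩ | ⟨i2, C1, β, h2, -⟩ := ih2
        · cases h1
          exact Or.inr ⟨i, A, [Sum.inr j], rfl, .base hb,
            .nonterm ((hg _ _).2 hα) hs .nil⟩
        · cases h2

/-! ### Context-free monoids -/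

/-- The word problems of finite families of elements of `M` are context-free. -/
def CFM (M : Type) [Monoid M] : Prop :=
  ∀ (Y : Type) (_ : Finite Y) (φ : Y → M), CF fun w : List Y => (w.map φ).prod = 1

theorem monoidContextFree_iff (M : Type) [Monoid M] : MonoidContextFree M ↔ CFM M := by
  constructor
  · intro h Y _ φ
    have := Fintype.ofFinite Y
    refine h Y this _ ⟨Y, this, ⊤, FreeMonoid.lift φ, .id _, ?_, ?_⟩
    · refine ⟨Unit, inferInstance, ⟨fun _ _ => (), (), Set.univ⟩, ?_⟩
      ext w
      exact ⟨fun _ => trivial, fun _ => trivial⟩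
    · ext w
      constructor
      · intro hw
        exact ⟨FreeMonoid.ofList w, ⟨trivial, (FreeMonoid.lift_apply φ _).trans hw⟩, rfl⟩
      · rintro ⟨u, ⟨-, hu⟩, rfl⟩
        exact (FreeMonoid.lift_apply φ u).symm.trans hu
  · rintro hM X _ L ⟨Y, _, R, φ, h, ⟨σ, _, D, rfl⟩, rfl⟩
    let step : Option σ → Option Y → Option σ → Prop := fun a y b =>
      ∃ s, a = some s ∧ ((∃ t, y = some t ∧ b = some (D.step s t)) ∨
        (y = none ∧ b = none ∧ s ∈ D.accept))
    have hstep : ∀ s w, Path step (some s) w none ↔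
        ∃ u : List Y, w = u.map some ++ [none] ∧ D.evalFrom s u ∈ D.accept := by
      intro s w
      induction w generalizing s with
      | nil =>
        constructor
        · intro h; cases h
        · rintro ⟨u, h, -⟩; simp at h
      | cons y w ih =>
        constructor
        · intro hp
          rcases hp with _ | ⟨⟨s', h1, ⟨t, rfl, rfl⟩ | ⟨rfl, rfl, h4⟩⟩, hp⟩
          · cases h1
            obtain ⟨u, rfl, hu⟩ := (ih _).1 hp
            exact ⟨t :: u, rfl, hu⟩
          · cases h1
            rcases hp with _ | ⟨⟨s', h1, -⟩, -⟩
            · exact ⟨[], rfl, h4⟩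
            · cases h1
        · rintro ⟨u, h, hu⟩
          cases u with
          | nil =>
            simp only [List.map_nil, List.nil_append, List.cons.injEq] at h
            obtain ⟨rfl, rfl⟩ := h
            exact .cons ⟨s, rfl, Or.inr ⟨rfl, rfl, hu⟩⟩ (.nil _)
          | cons t u =>
            simp only [List.map_cons, List.cons_append, List.cons.injEq] at h
            obtain ⟨rfl, rfl⟩ := h
            exact .cons ⟨s, rfl, Or.inl ⟨t, rfl, rfl⟩⟩ ((ih _).2 ⟨u, rfl, hu⟩)
    have h1 := ((hM (Option Y) inferInstance
      (fun y => y.elim 1 fun t => φ (.of t))).inter step (some D.start) none).flatMap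
      (fun y => y.elim [] fun t => (h (.of t)).toList)
    have hφ : ∀ u : List Y, (List.map (fun t => φ (.of t)) u).prod = φ (.ofList u) := by
      intro u
      conv_rhs => rw [← FreeMonoid.lift_restrict φ, FreeMonoid.lift_apply]
      rfl
    have hh : ∀ u : List Y, u.flatMap (fun t => (h (.of t)).toList) = (h (.ofList u)).toList := by
      intro u
      induction u with
      | nil => simp
      | cons t u ih => rw [FreeMonoid.ofList_cons, map_mul, FreeMonoid.toList_mul, ← ih]; rfl
    refine h1.congr fun w => ⟨?_, ?_⟩
    · rintro ⟨u, ⟨hu, hu1⟩, rfl⟩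
      refine ⟨u.toList.map some ++ [none], ⟨?_, (hstep _ _).2 ⟨_, rfl, hu⟩⟩, ?_⟩
      · simpa [Function.comp_def, hφ] using hu1
      · simp [List.flatMap_map, hh]
    · rintro ⟨v, ⟨hv1, hv⟩, rfl⟩
      obtain ⟨u, rfl, hu⟩ := (hstep _ _).1 hv
      refine ⟨FreeMonoid.ofList u, ⟨hu, ?_⟩, ?_⟩
      · simpa [Function.comp_def, hφ] using hv1
      · simp [List.flatMap_map, hh]

lemma CFM.of_injective {N M : Type} [Monoid N] [Monoid M] (h : CFM M) (f : N →* M)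
    (hf : Function.Injective f) : CFM N := fun Y _ φ =>
  (h Y ‹_› (f ∘ φ)).congr fun w => by
    rw [← List.map_map, List.prod_hom, ← hf.eq_iff, map_one]

theorem CFM.value {M Y : Type} [Monoid M] [Finite Y] (h : CFM M) (φ : Y → M) {c d : M}
    (hcd : c * d = 1) (hdc : d * c = 1) : CF fun w : List Y => (w.map φ).prod = c := by
  let step : Bool → Option Y → Bool → Prop := fun a y b => a = false ∧ b = y.isNone
  have hstep : ∀ w, Path step false w true ↔ ∃ u : List Y, w = u.map some ++ [none] := by
    intro w
    induction w with
    | nil =>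
      constructor
      · intro h; cases h
      · rintro ⟨u, h⟩; simp at h
    | cons y w ih =>
      constructor
      · intro hp
        rcases hp with _ | ⟨⟨-, rfl⟩, hp⟩
        cases y with
        | none =>
          rcases hp with _ | ⟨⟨h, -⟩, hp⟩
          · exact ⟨[], rfl⟩
          · cases h
        | some t =>
          obtain ⟨u, rfl⟩ := ih.1 hp
          exact ⟨t :: u, rfl⟩
      · rintro ⟨u, h⟩
        cases u with
        | nil =>
          simp only [List.map_nil, List.nil_append, List.cons.injEq] at h
          obtain ⟨rfl, rfl⟩ := h
          exact .cons ⟨rfl, rfl⟩ (.nil _)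
        | cons t u =>
          simp only [List.map_cons, List.cons_append, List.cons.injEq] at h
          obtain ⟨rfl, rfl⟩ := h
          exact .cons ⟨rfl, rfl⟩ (ih.2 ⟨u, rfl⟩)
  have hu : ∀ x : M, x * d = 1 ↔ x = c := fun x =>
    ⟨fun hx => by rw [← mul_one x, ← hdc, ← mul_assoc, hx, one_mul], fun hx => hx ▸ hcd⟩
  refine (((h (Option Y) inferInstance (fun y => y.elim d φ)).inter step false true).flatMap
    Option.toList).congr fun w => ⟨fun hw => ?_, ?_⟩
  · refine ⟨w.map some ++ [none], ⟨?_, (hstep _).2 ⟨w, rfl⟩⟩, ?_⟩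
    · simpa [Function.comp_def, hu] using hw
    · simp [List.flatMap_map]
  · rintro ⟨v, ⟨hv1, hv⟩, rfl⟩
    obtain ⟨u, rfl⟩ := (hstep _).1 hv
    simpa [Function.comp_def, List.flatMap_map, hu] using hv1

section Generators

variable {M Y : Type} [Monoid M] (l : Y → List M)

/-- A letter `y` together with a suffix of the word `l y` that spells it. -/
abbrev SpellLetter : Type := {z : Y × List M // z.2 <:+ l z.1}

instance [Finite Y] : Finite (SpellLetter l) := by
  have : (⋃ y : Y, (fun s => (y, s)) '' {s | s ∈ (l y).tails}).Finite :=
    Set.finite_iUnion fun y => (List.finite_toSet _).image _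
  refine Set.Finite.to_subtype (s := {z : Y × List M | z.2 <:+ l z.1}) (this.subset ?_)
  rintro ⟨y, s⟩ h
  exact Set.mem_iUnion.2 ⟨y, s, by simpa using h, rfl⟩

variable {l}

/-- Drop the first letter of the suffix. -/
def SpellLetter.tail (z : SpellLetter l) : SpellLetter l :=
  ⟨(z.1.1, z.1.2.tail), (List.tail_suffix _).trans z.2⟩

/-- The first letter of the suffix. -/
def SpellLetter.val (z : SpellLetter l) : M := z.1.2.headD 1

/-- The letter is output at the end of the spelling. -/
def SpellLetter.out (z : SpellLetter l) : List Y := if z.1.2 = [] then [z.1.1] else []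

variable (l) in
/-- The automaton reading complete spellings. -/
def spellStep (p : Option (SpellLetter l)) (z : SpellLetter l) (q : Option (SpellLetter l)) :
    Prop :=
  (p = some z ∨ p = none ∧ z.1.2 = l z.1.1) ∧ q = if z.1.2 = [] then none else some z.tail

lemma exists_spell (s : List M) (y : Y) (hs : s <:+ l y) (p : Option (SpellLetter l))
    (hp : p = some ⟨(y, s), hs⟩ ∨ p = none ∧ s = l y) :
    ∃ u, Path (spellStep l) p u none ∧ (u.map SpellLetter.val).prod = s.prod ∧
      u.flatMap SpellLetter.out = [y] := by
  induction s generalizing p with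
  | nil =>
    exact ⟨[⟨(y, []), hs⟩], .cons ⟨hp, rfl⟩ (.nil _), by simp [SpellLetter.val],
      by simp [SpellLetter.out]⟩
  | cons b s ih =>
    obtain ⟨u, h1, h2, h3⟩ := ih ((List.suffix_cons b s).trans hs) _ (Or.inl rfl)
    exact ⟨⟨(y, b :: s), hs⟩ :: u, .cons ⟨hp, rfl⟩ h1, by simp [SpellLetter.val, h2],
      by simp [SpellLetter.out, h3]⟩

lemma exists_spell_word (w : List Y) :
    ∃ u, Path (spellStep l) none u none ∧
      (u.map SpellLetter.val).prod = (w.map fun y => (l y).prod).prod ∧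
      u.flatMap SpellLetter.out = w := by
  induction w with
  | nil => exact ⟨[], .nil _, rfl, rfl⟩
  | cons y w ih =>
    obtain ⟨u, h1, h2, h3⟩ := exists_spell (l y) y (List.suffix_refl _) none (Or.inr ⟨rfl, rfl⟩)
    obtain ⟨v, h4, h5, h6⟩ := ih
    exact ⟨u ++ v, h1.append h4, by simp [h2, h5], by simp [h3, h6]⟩

lemma spell_sound {p q : Option (SpellLetter l)} {u : List (SpellLetter l)}
    (h : Path (spellStep l) p u q) (hq : q = none) :
    (p = none → (u.map SpellLetter.val).prod =
      ((u.flatMap SpellLetter.out).map fun y => (l y).prod).prod) ∧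
    ∀ z, p = some z → ∃ r, u.flatMap SpellLetter.out = z.1.1 :: r ∧
      (u.map SpellLetter.val).prod = z.1.2.prod * (r.map fun y => (l y).prod).prod := by
  induction h with
  | nil p =>
    subst hq
    exact ⟨fun _ => rfl, fun z hz => by cases hz⟩
  | @cons p q r z u hs _ ih =>
    obtain ⟨h1, h2⟩ := ih hq
    obtain ⟨hp, rfl⟩ := hs
    have key : ∃ r, (z :: u).flatMap SpellLetter.out = z.1.1 :: r ∧
        ((z :: u).map SpellLetter.val).prod =
          z.1.2.prod * (r.map fun y => (l y).prod).prod := by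
      obtain ⟨⟨y, s⟩, hs⟩ := z
      cases s with
      | nil =>
        refine ⟨_, by simp [SpellLetter.out]; rfl, ?_⟩
        simpa [SpellLetter.val] using h1 rfl
      | cons b s =>
        obtain ⟨r, h3, h4⟩ := h2 _ rfl
        refine ⟨r, by simpa [SpellLetter.out, SpellLetter.tail] using h3, ?_⟩
        simp [SpellLetter.val, h4, SpellLetter.tail, mul_assoc]
    constructor
    · rintro rfl
      obtain h | ⟨-, h⟩ := hp
      · cases h
      obtain ⟨r, h3, h4⟩ := key
      rw [h3, h4, h]
      simp
    · rintro z' rfl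
      obtain h | ⟨h, -⟩ := hp
      · cases h; exact key
      · cases h

theorem CFM.of_closure (B : Set M) (h1 : 1 ∈ B) (hB : Submonoid.closure B = ⊤)
    (h : ∀ (Y : Type) (_ : Finite Y) (φ : Y → M), (∀ y, φ y ∈ B) →
      CF fun w : List Y => (w.map φ).prod = 1) : CFM M := by
  intro Y _ φ
  have hl : ∀ y, ∃ s : List M, (∀ b ∈ s, b ∈ B) ∧ s.prod = φ y := fun y =>
    Submonoid.exists_list_of_mem_closure (by rw [hB]; trivial)
  choose l hl1 hl2 using hl
  have hval : ∀ z : SpellLetter l, z.val ∈ B := by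
    rintro ⟨⟨y, s⟩, hs⟩
    cases s with
    | nil => exact h1
    | cons b s => exact hl1 y b (hs.subset (by simp))
  refine (((h _ inferInstance SpellLetter.val hval).inter (spellStep l) none none).flatMap
    SpellLetter.out).congr fun w => ⟨fun hw => ?_, ?_⟩
  · obtain ⟨u, h2, h3, h4⟩ := exists_spell_word (l := l) w
    exact ⟨u, ⟨by simpa [h3, hl2] using hw, h2⟩, h4⟩
  · rintro ⟨u, ⟨h2, h3⟩, rfl⟩
    have := (spell_sound h3 rfl).1 rfl
    simpa [h2, hl2] using this.symm

end Generators

/-! ### Graph products: universal property -/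

namespace GraphProduct

variable {V : Type} {E : V → V → Prop} {M : V → Type} [∀ v, Monoid (M v)]

/-- The quotient map from the free monoid. -/
def mk : FreeMonoid (Σ v, M v) →* GraphProduct V E M := (conGen (GraphProdRel V E M)).mk'

lemma mk_surjective : Function.Surjective (mk (E := E) (M := M)) := Con.mk'_surjective

lemma mk_eq_of_rel {x y : FreeMonoid (Σ v, M v)} (h : GraphProdRel V E M x y) :
    mk (E := E) x = mk y :=
  (Con.eq _).2 (ConGen.Rel.of _ _ h)

variable (E) in
/-- The canonical map of a factor into the graph product. -/
def of (v : V) : M v →* GraphProduct V E M where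
  toFun a := mk (FreeMonoid.of ⟨v, a⟩)
  map_one' := by
    rw [← map_one mk]
    exact mk_eq_of_rel (Or.inr (Or.inl ⟨v, rfl, rfl⟩))
  map_mul' a b := by
    rw [← map_mul]
    exact (mk_eq_of_rel (Or.inl ⟨v, a, b, rfl, rfl⟩)).symm

lemma commute_of {v w : V} (h : E v w) (a : M v) (b : M w) : Commute (of E v a) (of E w b) := by
  change mk _ * mk _ = mk _ * mk _
  rw [← map_mul, ← map_mul]
  exact mk_eq_of_rel (Or.inr (Or.inr ⟨v, w, a, b, h, rfl, rfl⟩))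

/-- The universal property of the graph product. -/
def lift {N : Type*} [Monoid N] (f : ∀ v, M v →* N)
    (hf : ∀ v w, E v w → ∀ a b, Commute (f v a) (f w b)) : GraphProduct V E M →* N :=
  Con.lift _ (FreeMonoid.lift fun p => f p.1 p.2) <| Con.conGen_le.2 <| by
    rintro x y (⟨v, a, b, rfl, rfl⟩ | ⟨v, rfl, rfl⟩ | ⟨v, w, a, b, h, rfl, rfl⟩)
    · simp [Con.ker_rel]
    · simp [Con.ker_rel]
    · simpa [Con.ker_rel] using (hf v w h a b).eq

@[simp] lemma lift_of {N : Type*} [Monoid N] (f : ∀ v, M v →* N)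
    (hf : ∀ v w, E v w → ∀ a b, Commute (f v a) (f w b)) (v : V) (a : M v) :
    lift f hf (of E v a) = f v a := by
  change Con.lift _ _ _ (Con.toQuotient _) = _
  rw [Con.lift_coe, FreeMonoid.lift_eval_of]

@[elab_as_elim]
lemma induction {p : GraphProduct V E M → Prop} (one : p 1)
    (mul_of : ∀ x v (a : M v), p x → p (x * of E v a)) (x : GraphProduct V E M) : p x := by
  obtain ⟨w, rfl⟩ := mk_surjective x
  induction w using List.reverseRecOn with
  | nil => exact one
  | append_singleton w t ih => exact mul_of _ t.1 t.2 ih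

lemma hom_ext {N : Type*} [Monoid N] {f g : GraphProduct V E M →* N}
    (h : ∀ v a, f (of E v a) = g (of E v a)) : f = g := by
  ext x
  induction x using induction with
  | one => rw [map_one, map_one]
  | mul_of x v a ih => rw [map_mul, map_mul, ih, h]

lemma closure_of : Submonoid.closure {x | ∃ v a, of E v a = x} =
    (⊤ : Submonoid (GraphProduct V E M)) := by
  refine eq_top_iff.2 fun x _ => ?_
  induction x using induction with
  | one => exact one_mem _
  | mul_of x v a ih =>
    exact mul_mem (ih trivial) (Submonoid.subset_closure ⟨v, a, rfl⟩)

open Classical in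
/-- The endomorphism killing all factors outside a set of vertices. -/
noncomputable def restrict (S : Set V) : GraphProduct V E M →* GraphProduct V E M :=
  lift (fun v => if v ∈ S then of E v else 1) fun v w h a b => by
    split_ifs
    · exact commute_of h a b
    all_goals simp

lemma restrict_of_mem {S : Set V} {v : V} (h : v ∈ S) (a : M v) :
    restrict S (of E v a) = of E v a := by
  simp [restrict, h]

lemma restrict_of_notMem {S : Set V} {v : V} (h : v ∉ S) (a : M v) :
    restrict S (of E v a) = 1 := by
  simp [restrict, h]

lemma restrict_restrict_of_disjoint {S S' : Set V} (h : Disjoint S S')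
    (x : GraphProduct V E M) : restrict S (restrict S' x) = 1 := by
  induction x using induction with
  | one => simp
  | mul_of x v a ih =>
    rw [map_mul, map_mul, ih, one_mul]
    by_cases hv : v ∈ S'
    · rw [restrict_of_mem hv, restrict_of_notMem (Set.disjoint_right.1 h hv)]
    · rw [restrict_of_notMem hv, map_one]

lemma commute_restrict {S S' : Set V} (h : ∀ v ∈ S, ∀ w ∈ S', E v w)
    (x y : GraphProduct V E M) : Commute (restrict S x) (restrict S' y) := by
  induction x using induction with
  | one => simp
  | mul_of x v a ih =>
    rw [map_mul]
    refine ih.mul_left ?_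
    by_cases hv : v ∈ S
    · rw [restrict_of_mem hv]
      clear ih
      induction y using induction with
      | one => simp
      | mul_of y w b ih =>
        rw [map_mul]
        refine ih.mul_right ?_
        by_cases hw : w ∈ S'
        · rw [restrict_of_mem hw]
          exact commute_of (h v hv w hw) a b
        · rw [restrict_of_notMem hw]
          exact Commute.one_right _
    · rw [restrict_of_notMem hv]
      exact Commute.one_left _

open Classical in
/-- The retraction onto a factor. -/
noncomputable def proj (hirr : ∀ v, ¬ E v v) (v : V) : GraphProduct V E M →* M v :=
  lift (fun w => if h : w = v then (by subst h; exact MonoidHom.id _) else 1) fun u w h a b => by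
    split_ifs with h1 h2
    · subst h1 h2
      exact absurd h (hirr _)
    all_goals simp

lemma proj_of (hirr : ∀ v, ¬ E v v) (v : V) (a : M v) : proj hirr v (of E v a) = a := by
  simp [proj]

lemma of_injective (hirr : ∀ v, ¬ E v v) (v : V) : Function.Injective (of (M := M) E v) :=
  Function.LeftInverse.injective (proj_of hirr v)

end GraphProduct

/-! ### Graph products: normal forms -/

section Trace

variable {V : Type} (G : SimpleGraph V) (M : V → Type)

/-- Exchange of two consecutive letters from adjacent factors. -/
inductive Swap : List (Σ v, M v) → List (Σ v, M v) → Prop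
  | swap {x y : Σ v, M v} (h : G.Adj x.1 y.1) (l) : Swap (x :: y :: l) (y :: x :: l)
  | cons (x : Σ v, M v) {l l'} : Swap l l' → Swap (x :: l) (x :: l')

/-- Words up to commutation of letters from adjacent factors. -/
def Trace : Type := Quot (Swap G M)

variable {G M}

namespace Trace

/-- The empty trace. -/
def nil : Trace G M := Quot.mk _ []

/-- Prepend a letter. -/
def cons (x : Σ v, M v) : Trace G M → Trace G M :=
  Quot.map (List.cons x) fun _ _ h => h.cons x

/-- The number of letters. -/
def length : Trace G M → ℕ :=
  Quot.lift List.length fun _ _ h => by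
    induction h with
    | swap => rfl
    | cons x _ ih => simp [ih]

@[simp] lemma length_nil : (nil : Trace G M).length = 0 := rfl

@[simp] lemma length_cons (x : Σ v, M v) (t : Trace G M) :
    (cons x t).length = t.length + 1 := by
  induction t using Quot.ind; rfl

lemma cons_comm {x y : Σ v, M v} (h : G.Adj x.1 y.1) (t : Trace G M) :
    cons x (cons y t) = cons y (cons x t) := by
  induction t using Quot.ind with | mk l => exact Quot.sound (.swap h l)

@[elab_as_elim]
lemma induction {p : Trace G M → Prop} (hn : p nil) (hc : ∀ x t, p t → p (cons x t))
    (t : Trace G M) : p t := by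
  induction t using Quot.ind with | mk l =>
  induction l with
  | nil => exact hn
  | cons x l ih => exact hc x _ ih

open Classical in
/-- Auxiliary form of `pull` on words. -/
noncomputable def pullList (i : V) : List (Σ v, M v) → Option (M i × Trace G M)
  | [] => none
  | x :: l =>
    if h : x.1 = i then some (h ▸ x.2, Quot.mk _ l)
    else if G.Adj x.1 i then (pullList i l).map fun p => (p.1, cons x p.2) else none

/-- Move a letter of the factor `i` to the front, if possible. -/
noncomputable def pull (i : V) : Trace G M → Option (M i × Trace G M) :=
  Quot.lift (pullList i) fun _ _ h => by
    induction h with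
    | @swap x y h l =>
      obtain ⟨v, a⟩ := x
      obtain ⟨w, b⟩ := y
      simp only at h
      by_cases hv : v = i
      · subst hv
        have hw : w ≠ v := fun e => G.loopless.irrefl _ (e ▸ h)
        simp [pullList, hw, h.symm]
        rfl
      · by_cases hw : w = i
        · subst hw
          simp [pullList, hv, h]
          rfl
        · by_cases hv' : G.Adj v i <;> by_cases hw' : G.Adj w i <;>
            simp [pullList, hv, hw, hv', hw', Function.comp_def]
          congr 1
          funext p
          rw [cons_comm h]
    | @cons x l l' hs ih =>
      have : (Quot.mk _ l : Trace G M) = Quot.mk _ l' := Quot.sound hs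
      simp only [pullList, ih, this]

@[simp] lemma pull_nil (i : V) : pull i (nil : Trace G M) = none := rfl

lemma pull_cons_self (i : V) (a : M i) (t : Trace G M) :
    pull i (cons ⟨i, a⟩ t) = some (a, t) := by
  induction t using Quot.ind with | mk l =>
  change pullList i (⟨i, a⟩ :: l) = _
  simp [pullList]

lemma pull_cons_adj {i j : V} (h : G.Adj i j) (a : M i) (t : Trace G M) :
    pull j (cons ⟨i, a⟩ t) = (pull j t).map fun p => (p.1, cons ⟨i, a⟩ p.2) := by
  induction t using Quot.ind with | mk l =>
  change pullList j (⟨i, a⟩ :: l) = _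
  simp [pullList, h, h.ne]
  rfl

lemma pull_cons_of_not_adj {i j : V} (h : ¬ G.Adj i j) (hne : i ≠ j) (a : M i) (t : Trace G M) :
    pull j (cons ⟨i, a⟩ t) = none := by
  induction t using Quot.ind with | mk l =>
  change pullList j (⟨i, a⟩ :: l) = _
  simp [pullList, h, hne]

lemma eq_cons_of_pull {i : V} {b : M i} {t t' : Trace G M} (h : pull i t = some (b, t')) :
    t = cons ⟨i, b⟩ t' := by
  induction t using induction generalizing t' with
  | hn => simp at h
  | hc x t ih =>
    obtain ⟨j, a⟩ := x
    by_cases hj : j = i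
    · subst hj
      rw [pull_cons_self] at h
      cases h; rfl
    · by_cases ha : G.Adj j i
      · rw [pull_cons_adj ha, Option.map_eq_some_iff] at h
        obtain ⟨⟨b', s⟩, h1, h2⟩ := h
        cases h2
        rw [ih h1]
        exact cons_comm ha _
      · rw [pull_cons_of_not_adj ha hj] at h
        cases h

variable [∀ v, Monoid (M v)]

/-- Reduced traces. -/
inductive Red : Trace G M → Prop
  | nil : Red nil
  | cons {i : V} {a : M i} {t : Trace G M} : a ≠ 1 → pull i t = none → Red t →
      Red (cons ⟨i, a⟩ t)

lemma Red.of_pull {t : Trace G M} (ht : Red t) {j : V} {b : M j} {t' : Trace G M}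
    (h : pull j t = some (b, t')) : b ≠ 1 ∧ pull j t' = none ∧ Red t' := by
  induction ht generalizing t' with
  | nil => simp at h
  | @cons i a s ha hs hr ih =>
    by_cases hj : i = j
    · subst hj
      rw [pull_cons_self] at h
      cases h
      exact ⟨ha, hs, hr⟩
    · by_cases hadj : G.Adj i j
      · rw [pull_cons_adj hadj, Option.map_eq_some_iff] at h
        obtain ⟨⟨b', s'⟩, h1, h2⟩ := h
        cases h2
        obtain ⟨h3, h4, h5⟩ := ih h1
        refine ⟨h3, by rw [pull_cons_adj hadj, h4]; rfl, .cons ha ?_ h5⟩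
        rw [eq_cons_of_pull h1, pull_cons_adj hadj.symm] at hs
        simpa using hs
      · rw [pull_cons_of_not_adj hadj hj] at h
        cases h

/-- Split off the (possibly trivial) part in the factor `i`. -/
noncomputable def split (i : V) (t : Trace G M) : M i × Trace G M := (pull i t).getD (1, t)

open Classical in
/-- Prepend an element of the factor `i`. -/
noncomputable def push (i : V) (c : M i) (t : Trace G M) : Trace G M :=
  if c = 1 then t else cons ⟨i, c⟩ t

lemma push_one (i : V) (t : Trace G M) : push i 1 t = t := by simp [push]

lemma Red.push {i : V} {t : Trace G M} (ht : Red t) (h : pull i t = none) (c : M i) :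
    Red (Trace.push i c t) := by
  unfold Trace.push
  split_ifs with hc
  · exact ht
  · exact .cons hc h ht

lemma Red.split {t : Trace G M} (ht : Red t) (i : V) :
    Red (Trace.split i t).2 ∧ pull i (Trace.split i t).2 = none ∧
      Trace.push i (Trace.split i t).1 (Trace.split i t).2 = t := by
  unfold Trace.split
  cases h : pull i t with
  | none => simp [ht, h, push_one]
  | some p =>
    obtain ⟨b, t'⟩ := p
    obtain ⟨h1, h2, h3⟩ := ht.of_pull h
    simp [h2, h3, Trace.push, h1, eq_cons_of_pull h]

lemma split_push {i : V} {t : Trace G M} (h : pull i t = none) (c : M i) :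
    split i (push i c t) = (c, t) := by
  unfold split push
  split_ifs with hc
  · simp [h, hc]
  · simp [pull_cons_self]

lemma pull_push_adj {i j : V} (h : G.Adj i j) (c : M i) (t : Trace G M) :
    pull j (push i c t) = (pull j t).map fun p => (p.1, push i c p.2) := by
  unfold push
  split_ifs with hc
  · simp
  · exact pull_cons_adj h c t

lemma split_push_adj {i j : V} (h : G.Adj i j) (c : M i) (t : Trace G M) :
    split j (push i c t) = ((split j t).1, push i c (split j t).2) := by
  unfold split
  rw [pull_push_adj h]
  cases pull j t <;> rfl

lemma push_comm {i j : V} (h : G.Adj i j) (c : M i) (d : M j) (t : Trace G M) :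
    push i c (push j d t) = push j d (push i c t) := by
  unfold push
  split_ifs
  · rfl
  · rfl
  · rfl
  · exact cons_comm (x := ⟨i, c⟩) (y := ⟨j, d⟩) h t

/-- Multiply a trace by an element of a factor. -/
noncomputable def act (i : V) (a : M i) (t : Trace G M) : Trace G M :=
  push i ((split i t).1 * a) (split i t).2

lemma act_push {i : V} {t : Trace G M} (h : pull i t = none) (a c : M i) :
    act i a (push i c t) = push i (c * a) t := by
  unfold act
  rw [split_push h]

lemma act_push_adj {i j : V} (h : G.Adj i j) (c : M i) (b : M j) (t : Trace G M) :
    act j b (push i c t) = push i c (act j b t) := by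
  unfold act
  rw [split_push_adj h, push_comm h]

lemma Red.act {t : Trace G M} (ht : Red t) (i : V) (a : M i) : Red (Trace.act i a t) :=
  (ht.split i).1.push (ht.split i).2.1 _

lemma Red.pull_act_adj {t : Trace G M} (ht : Red t) {i j : V} (h : G.Adj i j) (a : M i) :
    pull j (Trace.act i a t) = none ↔ pull j t = none := by
  obtain ⟨-, -, h3⟩ := ht.split i
  conv_rhs => rw [← h3]
  unfold Trace.act
  rw [pull_push_adj h, pull_push_adj h]
  simp

lemma Red.act_comm {t : Trace G M} (ht : Red t) {i j : V} (h : G.Adj i j) (a : M i) (b : M j) :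
    Trace.act j b (Trace.act i a t) = Trace.act i a (Trace.act j b t) := by
  obtain ⟨h1, h2, h3⟩ := ht.split i
  rw [← h3, act_push h2, act_push_adj h, act_push_adj h, act_push]
  rwa [h1.pull_act_adj h.symm]

end Trace

end Trace

namespace GraphProduct

variable {V : Type} {G : SimpleGraph V} {M : V → Type} [∀ v, Monoid (M v)]

/-- The right action of the graph product on reduced traces. -/
noncomputable def action :
    GraphProduct V G.Adj M →* (Function.End {t : Trace G M // t.Red})ᵐᵒᵖ :=
  lift (fun i =>
    { toFun := fun a => .op fun t => ⟨t.1.act i a, t.2.act i a⟩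
      map_one' := by
        refine MulOpposite.unop_injective (funext fun t => Subtype.ext ?_)
        change Trace.act i 1 t.1 = t.1
        unfold Trace.act
        rw [mul_one]
        exact (t.2.split i).2.2
      map_mul' := fun a b => by
        refine MulOpposite.unop_injective (funext fun t => Subtype.ext ?_)
        change Trace.act i (a * b) t.1 = Trace.act i b (Trace.act i a t.1)
        obtain ⟨-, h2, h3⟩ := t.2.split i
        rw [← h3, Trace.act_push h2, Trace.act_push h2, Trace.act_push h2, mul_assoc] })
    fun i j h a b => by
      refine MulOpposite.unop_injective (funext fun t => Subtype.ext ?_)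
      exact t.2.act_comm h a b

/-- The normal form of an element. -/
noncomputable def nf (g : GraphProduct V G.Adj M) : {t : Trace G M // t.Red} :=
  (action g).unop ⟨.nil, .nil⟩

lemma nf_one : (nf (1 : GraphProduct V G.Adj M)).1 = .nil := by
  simp [nf]
  rfl

lemma nf_mul_of (g : GraphProduct V G.Adj M) (i : V) (a : M i) :
    (nf (g * of G.Adj i a)).1 = (nf g).1.act i a := by
  have h : (action (of G.Adj i a)).unop = fun t => ⟨t.1.act i a, t.2.act i a⟩ :=
    congrArg MulOpposite.unop (lift_of _ _ i a)
  unfold nf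
  rw [map_mul, MulOpposite.unop_mul, h]
  rfl

/-- The length of the normal form. -/
noncomputable def len (g : GraphProduct V G.Adj M) : ℕ := (nf g).1.length

/-- `i` is the factor of a possible last letter of `g`. -/
def Desc (g : GraphProduct V G.Adj M) (i : V) : Prop := (nf g).1.pull i ≠ none

lemma len_one : len (1 : GraphProduct V G.Adj M) = 0 := by
  simp [len, nf_one]

lemma not_desc_one (i : V) : ¬ Desc (1 : GraphProduct V G.Adj M) i := by
  simp [Desc, nf_one]

lemma nf_mul_of_of_not_desc {g : GraphProduct V G.Adj M} {i : V} (h : ¬ Desc g i) {a : M i}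
    (ha : a ≠ 1) : (nf (g * of G.Adj i a)).1 = .cons ⟨i, a⟩ (nf g).1 := by
  have h' : (nf g).1.pull i = none := by simpa [Desc] using h
  rw [nf_mul_of, Trace.act, Trace.split, h']
  simp [Trace.push, ha]

lemma len_mul_of_of_not_desc {g : GraphProduct V G.Adj M} {i : V} (h : ¬ Desc g i) {a : M i}
    (ha : a ≠ 1) : len (g * of G.Adj i a) = len g + 1 := by
  simp [len, nf_mul_of_of_not_desc h ha]

lemma not_desc_mul_of {g : GraphProduct V G.Adj M} {i j : V} (h : ¬ Desc g i) {a : M i}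
    (ha : a ≠ 1) (hij : ¬ G.Adj i j) (hne : i ≠ j) : ¬ Desc (g * of G.Adj i a) j := by
  simp [Desc, nf_mul_of_of_not_desc h ha, Trace.pull_cons_of_not_adj hij hne]

lemma desc_mul_of_adj (g : GraphProduct V G.Adj M) {i j : V} (h : G.Adj i j) (a : M i) :
    Desc (g * of G.Adj i a) j ↔ Desc g j := by
  unfold Desc
  rw [nf_mul_of, ne_eq, (nf g).2.pull_act_adj h]

lemma Desc.adj {g : GraphProduct V G.Adj M} {i j : V} (hi : Desc g i) (hj : Desc g j)
    (hne : i ≠ j) : G.Adj i j := by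
  by_contra h
  obtain ⟨⟨b, t⟩, hb⟩ := Option.ne_none_iff_exists'.1 hi
  exact hj (by rw [Trace.eq_cons_of_pull hb, Trace.pull_cons_of_not_adj h hne])

lemma length_push_le {i : V} (c : M i) (t : Trace G M) :
    (t.push i c).length ≤ t.length + 1 := by
  unfold Trace.push
  split_ifs <;> simp

lemma len_mul_of_le_of_desc {g : GraphProduct V G.Adj M} {i : V} (h : Desc g i) (a : M i) :
    len (g * of G.Adj i a) ≤ len g := by
  obtain ⟨⟨b, t⟩, hb⟩ := Option.ne_none_iff_exists'.1 h
  have h1 := congrArg Trace.length (Trace.eq_cons_of_pull hb)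
  rw [Trace.length_cons] at h1
  unfold len
  rw [nf_mul_of, h1, Trace.act, Trace.split, hb]
  exact length_push_le _ _

end GraphProduct

/-! ### Pumping-type properties of word problems -/

/-- A minimal subtree of a parse tree whose yield contains a given factor of length at least
two. -/
lemma BinGrammar.Gen.exists_split {T : Type} {g : BinGrammar T}
    (hlen : ∀ A w, g.base A w → w.length ≤ 1) {S : g.NT} {w : List T} (h : g.Gen S w)
    {w₁ w₂ w₃ : List T} (hw : w = w₁ ++ w₂ ++ w₃) (h₂ : 2 ≤ w₂.length) :
    ∃ (A B C : g.NT) (l b c d e f : List T), w₁ = l ++ b ∧ w₂ = c ++ d ∧ w₃ = e ++ f ∧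
      g.bin A B C ∧ g.Gen B (b ++ c) ∧ g.Gen C (d ++ e) ∧
      ∀ y, g.Gen A y → g.Gen S (l ++ y ++ f) := by
  induction h generalizing w₁ w₃ with
  | base hb =>
    have := hlen _ _ hb
    rw [hw] at this
    simp at this
    omega
  | @bin S B C u v hb hu hv ihu ihv =>
    obtain ⟨a, h1, rfl⟩ | ⟨a, rfl, rfl⟩ := List.append_eq_append_iff.1 hw
    · obtain ⟨c, rfl, rfl⟩ | ⟨c, rfl, rfl⟩ := List.append_eq_append_iff.1 h1
      · refine ⟨S, B, C, [], w₁, c, a, w₃, [], rfl, rfl, by simp, hb, hu, hv, fun y hA => ?_⟩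
        simpa using hA
      · obtain ⟨A', B', C', l, b, c', d, e, f, rfl, rfl, rfl, hb', hB, hC, hy⟩ :=
          ihv (w₁ := c) (w₃ := w₃) rfl
        refine ⟨A', B', C', u ++ l, b, c', d, e, f, by simp, rfl, rfl, hb', hB, hC, fun y hA => ?_⟩
        simpa using Gen.bin hb hu (hy y hA)
    · obtain ⟨A', B', C', l, b, c', d, e, f, rfl, rfl, rfl, hb', hB, hC, hy⟩ :=
        ihu (w₁ := w₁) (w₃ := a) rfl
      refine ⟨A', B', C', l, b, c', d, e, f ++ v, rfl, rfl, by simp, hb', hB, hC, fun y hA => ?_⟩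
      simpa using Gen.bin hb (hy y hA) hv

/-- If the word problem of a family of units is context-free, then triangles labelled by words
over these units are thin. -/
theorem CF.exists_triangle {M Y : Type} [Monoid M] {φ : Y → M} (hφ : ∀ y, IsUnit (φ y))
    (h : CF fun w : List Y => (w.map φ).prod = 1) :
    ∃ F : Set M, F.Finite ∧ ∀ w₁ w₂ w₃ : List Y, 2 ≤ w₂.length →
      ((w₁ ++ w₂ ++ w₃).map φ).prod = 1 →
      ∃ l b c d e f, w₁ = l ++ b ∧ w₂ = c ++ d ∧ w₃ = e ++ f ∧
        ((b ++ c).map φ).prod ∈ F ∧ ((d ++ e).map φ).prod ∈ F := by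
  obtain ⟨g, S, hlen, hg⟩ := h.exists_grammar
  have hunit : ∀ w : List Y, IsUnit (w.map φ).prod := by
    intro w
    induction w with
    | nil => simp
    | cons y w ih => simpa using (hφ y).mul ih
  have hrep : ∀ A : g.NT, ∃ y, ∀ u, g.Gen A u → g.Gen A y := fun A => by
    by_cases hA : ∃ u, g.Gen A u
    · obtain ⟨y, hy⟩ := hA
      exact ⟨y, fun _ _ => hy⟩
    · exact ⟨[], fun u hu => absurd ⟨u, hu⟩ hA⟩
  choose y hy using hrep
  have := g.finite
  refine ⟨Set.range fun A => ((y A).map φ).prod, Set.finite_range _, fun w₁ w₂ w₃ h2 h1 => ?_⟩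
  obtain ⟨A, B, C, l, b, c, d, e, f, rfl, rfl, rfl, hb, hB, hC, hA⟩ :=
    ((hg _).1 h1).exists_split hlen rfl h2
  refine ⟨l, b, c, d, e, f, rfl, rfl, rfl, ⟨B, ?_⟩, ⟨C, ?_⟩⟩
  · have h3 := (hg _).2 (hA _ (.bin hb (hy B _ hB) hC))
    have h4 := (hg _).2 (hA _ (.bin hb hB hC))
    rw [← h3] at h4
    simp only [List.map_append, List.prod_append] at h4 ⊢
    simp only [mul_assoc] at h4
    have h5 := (hunit l).mul_left_cancel h4
    simp only [← mul_assoc] at h5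
    exact ((hunit d).mul_right_cancel ((hunit e).mul_right_cancel
      ((hunit f).mul_right_cancel h5))).symm
  · have h3 := (hg _).2 (hA _ (.bin hb hB (hy C _ hC)))
    have h4 := (hg _).2 (hA _ (.bin hb hB hC))
    rw [← h3] at h4
    simp only [List.map_append, List.prod_append] at h4 ⊢
    have h5 := (hunit f).mul_right_cancel h4
    simp only [mul_assoc] at h5
    exact ((hunit c).mul_left_cancel ((hunit b).mul_left_cancel
      ((hunit l).mul_left_cancel h5))).symm

/-- Two infinite finitely generated submonoids whose elements are uniquely right, respectively
left, invertible by elements of the other one. -/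
structure DyckPair {M : Type} [Monoid M] (U W : Submonoid M) : Prop where
  fg_left : U.FG
  fg_right : W.FG
  infinite_left : (U : Set M).Infinite
  infinite_right : (W : Set M).Infinite
  exists_right : ∀ u ∈ U, ∃ w ∈ W, u * w = 1
  exists_left : ∀ w ∈ W, ∃ u ∈ U, u * w = 1
  unique_left : ∀ u ∈ U, ∀ u' ∈ U, ∀ x, u * x = 1 → u' * x = 1 → u = u'
  unique_right : ∀ w ∈ W, ∀ w' ∈ W, ∀ x, x * w = 1 → x * w' = 1 → w = w'

/-- Two commuting independent Dyck pairs have a word problem that is not context-free. -/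
theorem CFM.not_dyckPair {M : Type} [Monoid M] (h : CFM M) {U₁ W₁ U₂ W₂ : Submonoid M}
    (D₁ : DyckPair U₁ W₁) (D₂ : DyckPair U₂ W₂) (e₁ e₂ : M →* M)
    (h11 : ∀ x, x ∈ U₁ ∨ x ∈ W₁ → e₁ x = x) (h12 : ∀ x, x ∈ U₂ ∨ x ∈ W₂ → e₁ x = 1)
    (h21 : ∀ x, x ∈ U₁ ∨ x ∈ W₁ → e₂ x = 1) (h22 : ∀ x, x ∈ U₂ ∨ x ∈ W₂ → e₂ x = x)
    (hcomm : ∀ x ∈ W₁, ∀ y ∈ U₂, Commute x y) : False := by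
  classical
  obtain ⟨S₁, hS₁⟩ := D₁.fg_left
  obtain ⟨S₂, hS₂⟩ := D₁.fg_right
  obtain ⟨S₃, hS₃⟩ := D₂.fg_left
  obtain ⟨S₄, hS₄⟩ := D₂.fg_right
  let F : Finset M := S₁ ∪ S₂ ∪ S₃ ∪ S₄
  have hword : ∀ (N : Submonoid M) (S : Finset M), Submonoid.closure S = N → S ⊆ F → ∀ x ∈ N,
      ∃ w : List F, (∀ y ∈ w, y.1 ∈ N) ∧ (w.map Subtype.val).prod = x := by
    rintro N S rfl hS x hx
    obtain ⟨l, hl, rfl⟩ := Submonoid.exists_list_of_mem_closure hx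
    refine ⟨l.attach.map fun y => ⟨y.1, hS (hl _ y.2)⟩, ?_, ?_⟩
    · intro y hy
      obtain ⟨z, -, rfl⟩ := List.mem_map.1 hy
      exact Submonoid.subset_closure (hl _ z.2)
    · rw [List.map_map]
      exact congrArg List.prod (List.attach_map_subtype_val l)
  have hval : ∀ {N : Submonoid M} {w : List F}, (∀ y ∈ w, y.1 ∈ N) →
      (w.map Subtype.val).prod ∈ N := by
    intro N w hw
    refine N.list_prod_mem fun x hx => ?_
    obtain ⟨y, hy, rfl⟩ := List.mem_map.1 hx
    exact hw y hy
  obtain ⟨g, S, hlen, hg⟩ := (h F inferInstance Subtype.val).exists_grammar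
  have := g.finite
  let v : List F → M := fun w => (w.map Subtype.val).prod
  have hv : ∀ w w', v (w ++ w') = v w * v w' := fun w w' => by simp [v]
  have hg' : ∀ w, v w = 1 ↔ g.Gen S w := hg
  have hv' : ∀ w, v w = (w.map Subtype.val).prod := fun _ => rfl
  have hval' : ∀ {N : Submonoid M} {w : List F}, (∀ y ∈ w, y.1 ∈ N) → v w ∈ N := hval
  clear_value v
  have hrep : ∀ A : g.NT, ∃ y, ∀ u, g.Gen A u → g.Gen A y := fun A => by
    by_cases hA : ∃ u, g.Gen A u
    · obtain ⟨y, hy⟩ := hA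
      exact ⟨y, fun _ _ => hy⟩
    · exact ⟨[], fun u hu => absurd ⟨u, hu⟩ hA⟩
  choose y hy using hrep
  have hshape : ∀ (N N' : Submonoid M) (A : g.NT), ∃ b c, ∀ b' c' : List F,
      (∀ y ∈ b', y.1 ∈ N) → (∀ y ∈ c', y.1 ∈ N') → g.Gen A (b' ++ c') →
      (∀ y ∈ b, y.1 ∈ N) ∧ (∀ y ∈ c, y.1 ∈ N') ∧ g.Gen A (b ++ c) := fun N N' A => by
    by_cases hA : ∃ b c : List F, (∀ y ∈ b, y.1 ∈ N) ∧ (∀ y ∈ c, y.1 ∈ N') ∧ g.Gen A (b ++ c)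
    · obtain ⟨b, c, hbc⟩ := hA
      exact ⟨b, c, fun _ _ _ _ _ => hbc⟩
    · exact ⟨[], [], fun b' c' h1 h2 h3 => absurd ⟨b', c', h1, h2, h3⟩ hA⟩
  choose p q hpq using hshape U₁ U₂
  choose r s hrs using hshape W₁ W₂
  have hF₁ : {u | u ∈ U₁ ∧ ∃ A, u * e₁ (v (y A)) = 1}.Finite := by
    refine (Set.finite_iUnion (f := fun A => {u | u ∈ U₁ ∧ u * e₁ (v (y A)) = 1})
      fun A => Set.Subsingleton.finite ?_).subset ?_
    · rintro u ⟨hu, hu'⟩ u' ⟨h1, h2⟩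
      exact D₁.unique_left _ hu _ h1 _ hu' h2
    · rintro u ⟨hu, A, hA⟩
      exact Set.mem_iUnion.2 ⟨A, hu, hA⟩
  have hF₃ : {w | w ∈ W₂ ∧ ∃ A, e₂ (v (y A)) * w = 1}.Finite := by
    refine (Set.finite_iUnion (f := fun A => {w | w ∈ W₂ ∧ e₂ (v (y A)) * w = 1})
      fun A => Set.Subsingleton.finite ?_).subset ?_
    · rintro u ⟨hu, hu'⟩ u' ⟨h1, h2⟩
      exact D₂.unique_right _ hu _ h1 _ hu' h2
    · rintro u ⟨hu, A, hA⟩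
      exact Set.mem_iUnion.2 ⟨A, hu, hA⟩
  obtain ⟨x₁, hx₁, hx₁'⟩ := D₁.infinite_left.exists_notMem_finite
    ((hF₁.image2 (· * ·) (Set.finite_range fun B => v (p B))).insert 1)
  obtain ⟨x₄, hx₄, hx₄'⟩ := D₂.infinite_right.exists_notMem_finite
    (((Set.finite_range fun C => v (s C)).image2 (· * ·) hF₃).insert 1)
  obtain ⟨x₂, hx₂, h12'⟩ := D₁.exists_right x₁ hx₁
  obtain ⟨x₃, hx₃, h34⟩ := D₂.exists_left x₄ hx₄
  obtain ⟨a₁, ha₁, hva₁⟩ := hword U₁ S₁ hS₁ (by grind) x₁ hx₁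
  obtain ⟨a₂, ha₂, hva₂⟩ := hword W₁ S₂ hS₂ (by grind) x₂ hx₂
  obtain ⟨a₃, ha₃, hva₃⟩ := hword U₂ S₃ hS₃ (by grind) x₃ hx₃
  obtain ⟨a₄, ha₄, hva₄⟩ := hword W₂ S₄ hS₄ (by grind) x₄ hx₄
  rw [← hv'] at hva₁ hva₂ hva₃ hva₄
  rw [Set.mem_insert_iff, not_or] at hx₁' hx₄'
  have hne₂ : a₂ ≠ [] := by
    rintro rfl
    rw [hv', List.map_nil, List.prod_nil] at hva₂
    exact hx₁'.1 (by rw [← h12', ← hva₂, mul_one])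
  have hne₃ : a₃ ≠ [] := by
    rintro rfl
    rw [hv', List.map_nil, List.prod_nil] at hva₃
    exact hx₄'.1 (by rw [← h34, ← hva₃, one_mul])
  have hlen₂ : 2 ≤ (a₃ ++ a₂).length := by
    have := List.length_pos_iff.2 hne₂
    have := List.length_pos_iff.2 hne₃
    rw [List.length_append]
    omega
  have hone : v (a₁ ++ (a₃ ++ a₂) ++ a₄) = 1 := by
    simp only [hv, hva₁, hva₂, hva₃, hva₄]
    rw [← (hcomm x₂ hx₂ x₃ hx₃).eq, ← mul_assoc, h12', one_mul, h34]
  obtain ⟨A, B, C, l, b, c, d, e, f, rfl, hmid, rfl, hb, hB, hC, hA⟩ :=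
    ((hg' _).1 hone).exists_split hlen rfl hlen₂
  simp only [List.forall_mem_append] at ha₁ ha₄
  have hAy := (hg' _).2 (hA _ (hy A _ (.bin hb hB hC)))
  simp only [hv] at hAy
  have hl₁ : v l ∈ {u | u ∈ U₁ ∧ ∃ A, u * e₁ (v (y A)) = 1} := by
    refine ⟨hval' ha₁.1, A, ?_⟩
    have := congrArg e₁ hAy
    simpa only [map_mul, map_one, h11 _ (Or.inl (hval' ha₁.1)), h12 _ (Or.inr (hval' ha₄.2)),
      mul_one] using this
  have hf₃ : v f ∈ {w | w ∈ W₂ ∧ ∃ A, e₂ (v (y A)) * w = 1} := by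
    refine ⟨hval' ha₄.2, A, ?_⟩
    have := congrArg e₂ hAy
    simpa only [map_mul, map_one, h21 _ (Or.inl (hval' ha₁.1)), h22 _ (Or.inr (hval' ha₄.2)),
      one_mul] using this
  obtain ⟨m, rfl, rfl⟩ | ⟨m, rfl, rfl⟩ := List.append_eq_append_iff.1 hmid
  · simp only [List.forall_mem_append] at ha₂
    obtain ⟨hr, hs, hgen⟩ := hrs C d e ha₂.2 ha₄.1 hC
    have h1 := congrArg e₂ ((hg' _).2 (hA _ (.bin hb hB hgen)))
    simp only [hv, map_mul, map_one, h21 _ (Or.inl (hval' ha₁.1)),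
      h21 _ (Or.inl (hval' ha₁.2)), h22 _ (Or.inl (hval' ha₃)), h21 _ (Or.inr (hval' ha₂.1)),
      h21 _ (Or.inr (hval' hr)), h22 _ (Or.inr (hval' hs)), h22 _ (Or.inr (hval' ha₄.2)),
      one_mul, mul_assoc] at h1
    refine hx₄'.2 ⟨_, ⟨C, rfl⟩, _, hf₃, ?_⟩
    refine D₂.unique_right _ (mul_mem (hval' hs) (hval' ha₄.2)) _ hx₄ (v a₃) h1 ?_
    rw [hva₃, h34]
  · simp only [List.forall_mem_append] at ha₃
    obtain ⟨hp, hq, hgen⟩ := hpq B b c ha₁.2 ha₃.1 hB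
    have h1 := congrArg e₁ ((hg' _).2 (hA _ (.bin hb hgen hC)))
    simp only [hv, map_mul, map_one, h11 _ (Or.inl (hval' ha₁.1)),
      h11 _ (Or.inl (hval' hp)), h12 _ (Or.inl (hval' hq)), h12 _ (Or.inl (hval' ha₃.2)),
      h11 _ (Or.inr (hval' ha₂)), h12 _ (Or.inr (hval' ha₄.1)), h12 _ (Or.inr (hval' ha₄.2)),
      one_mul, mul_one] at h1
    refine hx₁'.2 ⟨_, hl₁, _, ⟨B, rfl⟩, ?_⟩
    refine D₁.unique_left _ (mul_mem (hval' ha₁.1) (hval' hp)) _ hx₁ (v a₂) ?_ ?_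
    · simpa only [mul_assoc] using h1
    · rw [hva₂, h12']

/-! ### FRI-monoids -/

section FRI

variable {M : Type} [Monoid M]

lemma isUnit_of_pow_eq_pow {a b : M} (hab : a * b = 1) {i j : ℕ} (hij : i < j)
    (h : a ^ i = a ^ j) : IsUnit a := by
  have h1 : a ^ i * b ^ i = 1 := by
    clear h hij
    induction i with
    | zero => simp
    | succ i ih => rw [pow_succ, pow_succ', mul_assoc, ← mul_assoc a b, hab, one_mul, ih]
  refine IsUnit.of_pow_eq_one (n := j - i) ?_ (by omega)
  rw [← h1]
  conv_rhs => rw [h, ← Nat.sub_add_cancel hij.le, pow_add, mul_assoc, h1, mul_one]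

lemma IsFRI.isUnit_of_mul_eq_one (h : IsFRI M) {a b : M} (hab : a * b = 1) :
    IsUnit a ∧ IsUnit b := by
  have ha : IsUnit a := by
    have hfin := h (Submonoid.closure {a, b})
      ⟨(Set.toFinite {a, b}).toFinset, by simp⟩
    have hpow : ∀ i : ℕ, a ^ i * b ^ i = 1 := by
      intro i
      induction i with
      | zero => simp
      | succ i ih => rw [pow_succ, pow_succ', mul_assoc, ← mul_assoc a b, hab, one_mul, ih]
    have hmem : ∀ x ∈ ({a, b} : Set M), ∀ i : ℕ, x ^ i ∈ Submonoid.closure {a, b} :=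
      fun x hx i => pow_mem (Submonoid.subset_closure hx) i
    obtain ⟨i, -, j, -, hij, h1⟩ := Set.infinite_univ.exists_ne_map_eq_of_mapsTo
      (f := fun i : ℕ => (⟨a ^ i, hmem a (by simp) i⟩ : Submonoid.closure {a, b}))
      (t := {x | ∃ y, x * y = 1})
      (fun i _ => ⟨⟨b ^ i, hmem b (by simp) i⟩, Subtype.ext (hpow i)⟩) hfin
    have h2 : a ^ i = a ^ j := congrArg Subtype.val h1
    rcases hij.lt_or_gt with hij | hij
    · exact isUnit_of_pow_eq_pow hab hij h2
    · exact isUnit_of_pow_eq_pow hab hij h2.symm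
  refine ⟨ha, ?_⟩
  obtain ⟨u, rfl⟩ := ha
  have : b = ((u⁻¹ : Mˣ) : M) := by rw [← Units.mul_right_inj u, hab, Units.mul_inv]
  exact this ▸ (u⁻¹).isUnit

lemma IsFRI.isUnit_of_mem_Jset (h : IsFRI M) {a : M} (ha : a ∈ Jset M) : IsUnit a := by
  obtain ⟨b, c, hbc⟩ := ha
  rw [mul_assoc] at hbc
  obtain ⟨⟨u, rfl⟩, -⟩ := h.isUnit_of_mul_eq_one hbc
  have h1 : a * c * u = 1 := by
    have : a * c = ((u⁻¹ : Mˣ) : M) := by rw [← Units.mul_right_inj u, hbc, Units.mul_inv]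
    rw [this, Units.inv_mul]
  rw [mul_assoc] at h1
  exact (h.isUnit_of_mul_eq_one h1).1

lemma IsFRI.finite_closure (h : IsFRI M) {F : Set M} (hF : F.Finite)
    (hu : ∀ x ∈ F, IsUnit x) : (Submonoid.closure F : Set M).Finite := by
  choose! inv hinv using fun x hx => (hu x hx).exists_right_inv
  choose! inv' hinv' using fun x hx => (hu x hx).exists_left_inv
  have hii : ∀ x ∈ F, inv' x = inv x := fun x hx => left_inv_eq_right_inv (hinv' x hx) (hinv x hx)
  let N := Submonoid.closure (F ∪ inv '' F)
  have hNfg : N.FG := ⟨(hF.union (hF.image inv)).toFinset, by simp [N]⟩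
  have hN : ∀ x ∈ N, ∃ y ∈ N, x * y = 1 := by
    intro x hx
    induction hx using Submonoid.closure_induction with
    | mem x hx =>
      obtain hx | ⟨y, hy, rfl⟩ := hx
      · exact ⟨inv x, Submonoid.subset_closure (Or.inr ⟨x, hx, rfl⟩), hinv x hx⟩
      · exact ⟨y, Submonoid.subset_closure (Or.inl hy), by rw [← hii y hy]; exact hinv' y hy⟩
    | one => exact ⟨1, one_mem _, one_mul 1⟩
    | mul x y _ _ ihx ihy =>
      obtain ⟨x', hx', hx⟩ := ihx
      obtain ⟨y', hy', hy⟩ := ihy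
      exact ⟨y' * x', mul_mem hy' hx', by rw [mul_assoc, ← mul_assoc y, hy, one_mul, hx]⟩
  refine ((h N hNfg).image Subtype.val).subset fun x hx => ?_
  have hx' : x ∈ N := Submonoid.closure_mono Set.subset_union_left hx
  obtain ⟨y, hy, hxy⟩ := hN x hx'
  exact ⟨⟨x, hx'⟩, ⟨⟨y, hy⟩, Subtype.ext hxy⟩, rfl⟩

lemma DyckPair.of_group {U : Submonoid M} (hfg : U.FG) (hinf : (U : Set M).Infinite)
    (h : ∀ u ∈ U, ∃ w ∈ U, u * w = 1 ∧ w * u = 1) : DyckPair U U where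
  fg_left := hfg
  fg_right := hfg
  infinite_left := hinf
  infinite_right := hinf
  exists_right u hu := by
    obtain ⟨w, hw, h1, -⟩ := h u hu
    exact ⟨w, hw, h1⟩
  exists_left u hu := by
    obtain ⟨w, hw, -, h1⟩ := h u hu
    exact ⟨w, hw, h1⟩
  unique_left u hu u' hu' x h1 h2 := by
    obtain ⟨w, -, h3, h4⟩ := h u hu
    have hx : x = w := by rw [← one_mul x, ← h4, mul_assoc, h1, mul_one]
    subst hx
    rw [← mul_one u', ← h4, ← mul_assoc, h2, one_mul]
  unique_right u hu u' hu' x h1 h2 := by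
    obtain ⟨w, -, h3, h4⟩ := h u hu
    have hx : x = w := by rw [← mul_one x, ← h3, ← mul_assoc, h1, one_mul]
    subst hx
    rw [← one_mul u', ← h3, mul_assoc, h2, mul_one]

lemma exists_dyckPair_of_not_isFRI (h : ¬ IsFRI M) : ∃ U W : Submonoid M, DyckPair U W := by
  by_cases hded : ∀ a b : M, a * b = 1 → b * a = 1
  · unfold IsFRI at h
    push Not at h
    obtain ⟨N, ⟨S, hS⟩, hinf⟩ := h
    let T : Set M := {x | x ∈ S ∧ ∃ y ∈ N, x * y = 1}
    let U := Submonoid.closure T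
    have hSN : ∀ x ∈ S, x ∈ N := fun x hx => hS ▸ Submonoid.subset_closure hx
    have hU : ∀ x ∈ N, ∀ y ∈ N, x * y = 1 → x ∈ U := by
      intro x hx y hy hxy
      rw [← hS] at hx
      obtain ⟨l, hl, rfl⟩ := Submonoid.exists_list_of_mem_closure hx
      clear hx
      induction l generalizing y with
      | nil => exact one_mem _
      | cons s l ih =>
        simp only [List.forall_mem_cons] at hl
        have hlN : l.prod ∈ N := N.list_prod_mem fun x hx => hSN x (hl.2 x hx)
        rw [List.prod_cons] at hxy ⊢
        refine mul_mem (Submonoid.subset_closure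
          ⟨hl.1, l.prod * y, mul_mem hlN hy, by rw [← mul_assoc, hxy]⟩) ?_
        refine ih (y * s) (mul_mem hy (hSN s hl.1)) hl.2 ?_
        rw [← mul_assoc]
        exact hded _ _ (by rw [← mul_assoc, hxy])
    have hU' : ∀ x ∈ U, ∃ y ∈ N, x * y = 1 := by
      intro x hx
      induction hx using Submonoid.closure_induction with
      | mem x hx => exact hx.2
      | one => exact ⟨1, one_mem _, one_mul 1⟩
      | mul x y _ _ ihx ihy =>
        obtain ⟨x', hx', hx⟩ := ihx
        obtain ⟨y', hy', hy⟩ := ihy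
        exact ⟨y' * x', mul_mem hy' hx', by rw [mul_assoc, ← mul_assoc y, hy, one_mul, hx]⟩
    have hUN : U ≤ N := (Submonoid.closure_le).2 fun x hx => hSN x hx.1
    refine ⟨U, U, .of_group ?_ ?_ ?_⟩
    · have : T.Finite := S.finite_toSet.subset fun x hx => hx.1
      exact ⟨this.toFinset, by simp [U]⟩
    · refine (hinf.image Subtype.val_injective.injOn).mono ?_
      rintro _ ⟨x, ⟨y, hxy⟩, rfl⟩
      exact hU x.1 x.2 y.1 y.2 (congrArg Subtype.val hxy)
    · intro u hu
      obtain ⟨y, hy, huy⟩ := hU' u hu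
      exact ⟨y, hU y hy u (hUN hu) (hded _ _ huy), huy, hded _ _ huy⟩
  · push Not at hded
    obtain ⟨a, b, hab, hba⟩ := hded
    have ha : ¬ IsUnit a := by
      rintro ⟨u, rfl⟩
      have : b = ((u⁻¹ : Mˣ) : M) := by rw [← Units.mul_right_inj u, hab, Units.mul_inv]
      exact hba (by rw [this, Units.inv_mul])
    have hb : ¬ IsUnit b := by
      rintro ⟨u, rfl⟩
      have : a = ((u⁻¹ : Mˣ) : M) := by rw [← Units.mul_left_inj u, hab, Units.inv_mul]
      exact hba (by rw [this, Units.mul_inv])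
    have hpow : ∀ i : ℕ, a ^ i * b ^ i = 1 := by
      intro i
      induction i with
      | zero => simp
      | succ i ih => rw [pow_succ, pow_succ', mul_assoc, ← mul_assoc a b, hab, one_mul, ih]
    have key1 : ∀ i j : ℕ, i < j → ∀ x, a ^ i * x = 1 → a ^ j * x = 1 → False := by
      intro i j hij x h1 h2
      rw [← Nat.sub_add_cancel hij.le, pow_add, mul_assoc, h1, mul_one] at h2
      exact ha (IsUnit.of_pow_eq_one h2 (by omega))
    have key2 : ∀ i j : ℕ, i < j → ∀ x, x * b ^ i = 1 → x * b ^ j = 1 → False := by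
      intro i j hij x h1 h2
      rw [← Nat.add_sub_cancel' hij.le, pow_add, ← mul_assoc, h1, one_mul] at h2
      exact hb (IsUnit.of_pow_eq_one h2 (by omega))
    refine ⟨Submonoid.closure {a}, Submonoid.closure {b}, ⟨{a}, by simp⟩, ⟨{b}, by simp⟩,
      ?_, ?_, ?_, ?_, ?_, ?_⟩
    · refine (Set.infinite_range_of_injective (f := fun i : ℕ => a ^ i) fun i j hij => ?_).mono ?_
      · have hij : a ^ i = a ^ j := hij
        rcases lt_trichotomy i j with h | h | h
        · exact (key1 i j h _ (hpow i) (by rw [← hij, hpow])).elim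
        · exact h
        · exact (key1 j i h _ (hpow j) (by rw [hij, hpow])).elim
      · rintro _ ⟨i, rfl⟩
        exact pow_mem (Submonoid.mem_closure_singleton_self) i
    · refine (Set.infinite_range_of_injective (f := fun i : ℕ => b ^ i) fun i j hij => ?_).mono ?_
      · have hij : b ^ i = b ^ j := hij
        rcases lt_trichotomy i j with h | h | h
        · exact (key2 i j h _ (hpow i) (by rw [← hij, hpow])).elim
        · exact h
        · exact (key2 j i h _ (hpow j) (by rw [hij, hpow])).elim
      · rintro _ ⟨i, rfl⟩
        exact pow_mem (Submonoid.mem_closure_singleton_self) i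
    · intro u hu
      obtain ⟨i, rfl⟩ := Submonoid.mem_closure_singleton.1 hu
      exact ⟨b ^ i, pow_mem Submonoid.mem_closure_singleton_self i, hpow i⟩
    · intro u hu
      obtain ⟨i, rfl⟩ := Submonoid.mem_closure_singleton.1 hu
      exact ⟨a ^ i, pow_mem Submonoid.mem_closure_singleton_self i, hpow i⟩
    · intro u hu u' hu' x h1 h2
      obtain ⟨i, rfl⟩ := Submonoid.mem_closure_singleton.1 hu
      obtain ⟨j, rfl⟩ := Submonoid.mem_closure_singleton.1 hu'
      rcases lt_trichotomy i j with h | h | h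
      · exact (key1 i j h _ h1 h2).elim
      · rw [h]
      · exact (key1 j i h _ h2 h1).elim
    · intro u hu u' hu' x h1 h2
      obtain ⟨i, rfl⟩ := Submonoid.mem_closure_singleton.1 hu
      obtain ⟨j, rfl⟩ := Submonoid.mem_closure_singleton.1 hu'
      rcases lt_trichotomy i j with h | h | h
      · exact (key2 i j h _ h1 h2).elim
      · rw [h]
      · exact (key2 j i h _ h2 h1).elim

lemma DyckPair.map {N : Type} [Monoid N] {U W : Submonoid M} (D : DyckPair U W) (f : M →* N)
    (r : N →* M) (hr : ∀ x, r (f x) = x) : DyckPair (U.map f) (W.map f) where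
  fg_left := D.fg_left.map f
  fg_right := D.fg_right.map f
  infinite_left := D.infinite_left.image (Function.LeftInverse.injective hr).injOn
  infinite_right := D.infinite_right.image (Function.LeftInverse.injective hr).injOn
  exists_right := by
    rintro _ ⟨u, hu, rfl⟩
    obtain ⟨w, hw, h⟩ := D.exists_right u hu
    exact ⟨f w, ⟨w, hw, rfl⟩, by rw [← map_mul, h, map_one]⟩
  exists_left := by
    rintro _ ⟨u, hu, rfl⟩
    obtain ⟨w, hw, h⟩ := D.exists_left u hu
    exact ⟨f w, ⟨w, hw, rfl⟩, by rw [← map_mul, h, map_one]⟩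
  unique_left := by
    rintro _ ⟨u, hu, rfl⟩ _ ⟨u', hu', rfl⟩ x h h'
    refine congrArg f (D.unique_left u hu u' hu' (r x) ?_ ?_)
    · simpa [hr] using congrArg r h
    · simpa [hr] using congrArg r h'
  unique_right := by
    rintro _ ⟨u, hu, rfl⟩ _ ⟨u', hu', rfl⟩ x h h'
    refine congrArg f (D.unique_right u hu u' hu' (r x) ?_ ?_)
    · simpa [hr] using congrArg r h
    · simpa [hr] using congrArg r h'

end FRI

/-! ### Joins of subgraphs -/

namespace GraphProduct

variable {V : Type} {G : SimpleGraph V} {M : V → Type} [∀ v, Monoid (M v)]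

variable (G M) in
/-- There is a Dyck pair supported on the set of vertices `S`. -/
def DyckOn (S : Set V) : Prop :=
  ∃ U W : Submonoid (GraphProduct V G.Adj M), DyckPair U W ∧
    ∀ x, x ∈ U ∨ x ∈ W → restrict S x = x

lemma dyckOn_of_not_isFRI {v : V} (h : ¬ IsFRI (M v)) {S : Set V} (hv : v ∈ S) :
    DyckOn G M S := by
  obtain ⟨U, W, D⟩ := exists_dyckPair_of_not_isFRI h
  refine ⟨_, _, D.map (of G.Adj v) (proj (fun v => G.loopless.irrefl v) v) (proj_of _ v), ?_⟩
  rintro _ (⟨x, -, rfl⟩ | ⟨x, -, rfl⟩) <;> exact restrict_of_mem hv x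

lemma dyckOn_pair {u w : V} (huw : ¬ G.Adj u w) (hne : u ≠ w)
    (hu : ∃ a : M u, a ≠ 1 ∧ a ∈ Jset (M u)) (hw : ∃ a : M w, a ≠ 1 ∧ a ∈ Jset (M w)) :
    DyckOn G M {u, w} := by
  by_cases hFu : IsFRI (M u)
  swap
  · exact dyckOn_of_not_isFRI hFu (by simp)
  by_cases hFw : IsFRI (M w)
  swap
  · exact dyckOn_of_not_isFRI hFw (by simp)
  obtain ⟨a, ha, haJ⟩ := hu
  obtain ⟨b, hb, hbJ⟩ := hw
  obtain ⟨s, hs⟩ := ((hFu.isUnit_of_mem_Jset haJ).map (of G.Adj u)).mul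
    ((hFw.isUnit_of_mem_Jset hbJ).map (of G.Adj w))
  have hpow : ∀ n : ℕ, ¬ Desc (s.1 ^ n) u ∧ len (s.1 ^ n) = 2 * n := by
    intro n
    induction n with
    | zero => simp [not_desc_one, len_one]
    | succ n ih =>
      have h1 := not_desc_mul_of ih.1 ha huw hne
      have h2 : s.1 ^ (n + 1) = s.1 ^ n * of G.Adj u a * of G.Adj w b := by
        rw [pow_succ, mul_assoc, ← hs]
      rw [h2, len_mul_of_of_not_desc h1 hb, len_mul_of_of_not_desc ih.1 ha,
        ih.2]
      exact ⟨not_desc_mul_of h1 hb (fun h => huw h.symm) hne.symm, by ring⟩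
  have hinv : ∀ x ∈ Submonoid.closure {s.1, (s⁻¹).1},
      ∃ y ∈ Submonoid.closure {s.1, (s⁻¹).1}, x * y = 1 ∧ y * x = 1 := by
    intro x hx
    induction hx using Submonoid.closure_induction with
    | mem x hx =>
      obtain rfl | rfl := hx
      · exact ⟨(s⁻¹).1, Submonoid.subset_closure (by simp), s.mul_inv, s.inv_mul⟩
      · exact ⟨s.1, Submonoid.subset_closure (by simp), s.inv_mul, s.mul_inv⟩
    | one => exact ⟨1, one_mem _, one_mul 1, one_mul 1⟩
    | mul x y _ _ ihx ihy =>
      obtain ⟨x', hx', hx1, hx2⟩ := ihx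
      obtain ⟨y', hy', hy1, hy2⟩ := ihy
      exact ⟨y' * x', mul_mem hy' hx', by rw [mul_assoc, ← mul_assoc y, hy1, one_mul, hx1],
        by rw [mul_assoc, ← mul_assoc x', hx2, one_mul, hy2]⟩
  have hr : restrict {u, w} s.1 = s.1 := by
    rw [hs, map_mul, restrict_of_mem (by simp), restrict_of_mem (by simp)]
  refine ⟨_, _, .of_group (U := Submonoid.closure {s.1, (s⁻¹).1}) 
    ⟨(Set.toFinite {s.1, (s⁻¹).1}).toFinset, by simp⟩ ?_ hinv, ?_⟩
  · refine (Set.infinite_range_of_injective (f := fun i : ℕ => s.1 ^ i) fun i j hij => ?_).mono ?_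
    · have := congrArg len hij
      simp only [(hpow _).2] at this
      omega
    · rintro _ ⟨i, rfl⟩
      exact pow_mem (Submonoid.subset_closure (by simp)) i
  · intro x hx
    rw [or_self] at hx
    induction hx using Submonoid.closure_induction with
    | mem x hx =>
      obtain rfl | rfl := hx
      · exact hr
      · rw [← Units.mul_right_inj s, Units.mul_inv]
        conv_lhs => rw [← hr]
        rw [← map_mul, Units.mul_inv, map_one]
    | one => exact map_one _
    | mul x y _ _ ihx ihy => rw [map_mul, ihx, ihy]

theorem not_dyckOn_join (h : CFM (GraphProduct V G.Adj M)) {S S' : Set V}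
    (hS : ∀ v ∈ S, ∀ w ∈ S', G.Adj v w) (D : DyckOn G M S) (D' : DyckOn G M S') : False := by
  obtain ⟨U, W, hD, hr⟩ := D
  obtain ⟨U', W', hD', hr'⟩ := D'
  have hdis : Disjoint S S' := Set.disjoint_left.2 fun v h1 h2 => (hS v h1 v h2).ne rfl
  refine h.not_dyckPair hD hD' (restrict S) (restrict S') hr (fun x hx => ?_) (fun x hx => ?_) hr'
    fun x hx y hy => ?_
  · rw [← hr' x hx, restrict_restrict_of_disjoint hdis]
  · rw [← hr x hx, restrict_restrict_of_disjoint hdis.symm]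
  · rw [← hr x (Or.inr hx), ← hr' y (Or.inl hy)]
    exact commute_restrict hS x y

end GraphProduct

/-! ### Induced cycles -/

section ZModArc

variable {n : ℕ}

lemma natCast_zmod_inj {a b : ℕ} (h : (a : ZMod n) = b) (ha : a < n) (hb : b < n) : a = b := by
  rw [ZMod.natCast_eq_natCast_iff', Nat.mod_eq_of_lt ha, Nat.mod_eq_of_lt hb] at h
  exact h

lemma zmod_small_ne_zero (hn : 4 ≤ n) :
    (1 : ZMod n) ≠ 0 ∧ (2 : ZMod n) ≠ 0 ∧ (3 : ZMod n) ≠ 0 := by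
  refine ⟨fun h => ?_, fun h => ?_, fun h => ?_⟩
  · exact absurd (natCast_zmod_inj (n := n) (a := 1) (b := 0) (by simpa using h)
      (by omega) (by omega)) (by omega)
  · exact absurd (natCast_zmod_inj (n := n) (a := 2) (b := 0) (by simpa using h)
      (by omega) (by omega)) (by omega)
  · exact absurd (natCast_zmod_inj (n := n) (a := 3) (b := 0) (by simpa using h)
      (by omega) (by omega)) (by omega)

lemma not_cycle_adj (hn : 4 ≤ n) (k : ZMod n) :
    ¬ (k = k + 2 ∨ k + 2 = k + 1 ∨ k = k + 2 + 1) := by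
  obtain ⟨h1, h2, h3⟩ := zmod_small_ne_zero hn
  rintro (h | h | h)
  · exact h2 (by linear_combination -h)
  · exact h1 (by linear_combination h)
  · exact h3 (by linear_combination -h)

/-- The complement of a clique of a cycle of length at least four is an arc. -/
lemma exists_arc (hn : 4 ≤ n) (D : ZMod n → Prop)
    (hD : ∀ i j, D i → D j → i = j ∨ j = i + 1 ∨ i = j + 1) :
    ∃ d : ZMod n, ∀ i, ¬ D i → ∃ m : ℕ, i = d + m ∧ ∀ m' ≤ m, ¬ D (d + m') := by
  have : NeZero n := ⟨by omega⟩
  by_cases hex : ∃ d, D d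
  swap
  · push Not at hex
    exact ⟨0, fun i _ => ⟨i.val, by simp, fun m' _ => hex _⟩⟩
  obtain ⟨e, he, he1⟩ : ∃ e, D e ∧ ¬ D (e + 1) := by
    obtain ⟨d, hd⟩ := hex
    by_cases h1 : D (d + 1)
    · refine ⟨d + 1, h1, fun h2 => not_cycle_adj hn d ?_⟩
      have h3 : d + 1 + 1 = d + 2 := by ring
      rw [h3] at h2
      exact hD _ _ hd h2
    · exact ⟨d, hd, h1⟩
  refine ⟨e + 1, fun i hi => ?_⟩
  have hm : ((i - (e + 1)).val : ZMod n) = i - (e + 1) := ZMod.natCast_zmod_val _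
  have hlt : (i - (e + 1)).val < n := ZMod.val_lt _
  generalize (i - (e + 1)).val = m at hm hlt
  have hn1 : ((n - 1 : ℕ) : ZMod n) = -1 := by
    rw [Nat.cast_sub (by omega)]; simp
  have hn2 : ((n - 2 : ℕ) : ZMod n) = -2 := by
    rw [Nat.cast_sub (by omega)]; simp
  have hm1 : m ≠ n - 1 := by
    rintro rfl
    have : i = e := by linear_combination hn1 - hm
    exact hi (this ▸ he)
  refine ⟨m, by rw [hm]; ring, fun m' hm' hDm => ?_⟩
  rcases hD _ _ he hDm with h | h | h
  · have : m' = n - 1 := natCast_zmod_inj (n := n) (by linear_combination -h - hn1)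
      (by omega) (by omega)
    omega
  · exact he1 (h ▸ hDm)
  · have : m' = n - 2 := natCast_zmod_inj (n := n) (by linear_combination -h - hn2)
      (by omega) (by omega)
    have h' : m = m' := by omega
    subst h'
    refine hi ?_
    have : i = e + 1 + m := by rw [hm]; ring
    exact this ▸ hDm

end ZModArc

namespace GraphProduct

variable {V : Type} {G : SimpleGraph V} {M : V → Type} [∀ v, Monoid (M v)]

section Cycle

variable {n : ℕ} {c : ZMod n → V} (g : ∀ i, (M (c i))ˣ)

variable (G) in
/-- The letters of a cycle of units, and their inverses. -/
def letter (y : ZMod n × Bool) : GraphProduct V G.Adj M :=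
  of G.Adj (c y.1) (bif y.2 then (g y.1).1 else (g y.1)⁻¹.1)

lemma letter_mul_not (y : ZMod n × Bool) : letter G g y * letter G g (y.1, !y.2) = 1 := by
  obtain ⟨i, b⟩ := y
  cases b <;> simp [letter, ← map_mul]

variable (G) in
/-- A step along a letter that stays at distance at least `r` from the identity. -/
def FarStep (r : ℕ) (x z : GraphProduct V G.Adj M) : Prop :=
  r ≤ len x ∧ r ≤ len z ∧ ∃ y, z = x * letter G g y

variable {g}

lemma FarStep.symm {r : ℕ} {x z : GraphProduct V G.Adj M} (h : FarStep G g r x z) :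
    FarStep G g r z x := by
  obtain ⟨h1, h2, y, rfl⟩ := h
  exact ⟨h2, h1, (y.1, !y.2), by rw [mul_assoc, letter_mul_not, mul_one]⟩

lemma farStep_symm {r : ℕ} {x z : GraphProduct V G.Adj M}
    (h : Relation.ReflTransGen (FarStep G g r) x z) :
    Relation.ReflTransGen (FarStep G g r) z x := by
  have : Std.Symm (FarStep G g r) := ⟨fun _ _ => FarStep.symm⟩
  exact Std.Symm.symm _ _ h

lemma letter_arg_ne_one (hg : ∀ i, g i ≠ 1) (y : ZMod n × Bool) :
    (bif y.2 then (g y.1).1 else (g y.1)⁻¹.1) ≠ 1 := by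
  obtain ⟨i, b⟩ := y
  cases b <;> simp [hg i]

lemma len_mul_letter (hg : ∀ i, g i ≠ 1) {z : GraphProduct V G.Adj M} {y : ZMod n × Bool}
    (h : ¬ Desc z (c y.1)) : len (z * letter G g y) = len z + 1 :=
  len_mul_of_of_not_desc h (letter_arg_ne_one hg y)

/-- `c` parametrizes an induced cycle. -/
def IsCycle (G : SimpleGraph V) (c : ZMod n → V) : Prop :=
  Function.Injective c ∧ ∀ i j, G.Adj (c i) (c j) ↔ (j = i + 1 ∨ i = j + 1)

lemma IsCycle.desc (hc : IsCycle G c) (z : GraphProduct V G.Adj M) (i j : ZMod n)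
    (hi : Desc z (c i)) (hj : Desc z (c j)) : i = j ∨ j = i + 1 ∨ i = j + 1 := by
  by_cases hij : i = j
  · exact Or.inl hij
  · exact Or.inr ((hc.2 i j).1 (hi.adj hj fun h => hij (hc.1 h)))

lemma IsCycle.exists_adj_not_desc (hc : IsCycle G c) (hn : 4 ≤ n) (z : GraphProduct V G.Adj M)
    (k : ZMod n) : ∃ j, G.Adj (c k) (c j) ∧ ¬ Desc z (c j) := by
  by_cases h1 : Desc z (c (k + 1))
  · refine ⟨k - 1, (hc.2 _ _).2 (Or.inr (by ring)), fun h2 => not_cycle_adj hn (k - 1) ?_⟩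
    have h3 : k - 1 + 2 = k + 1 := by ring
    rw [h3]
    exact hc.desc z _ _ h2 h1
  · exact ⟨k + 1, (hc.2 _ _).2 (Or.inl rfl), h1⟩

lemma letter_comm (y y' : ZMod n × Bool) (h : G.Adj (c y.1) (c y'.1)) :
    letter G g y * letter G g y' = letter G g y' * letter G g y :=
  commute_of h _ _

lemma far_of_adj (hg : ∀ i, g i ≠ 1) {z : GraphProduct V G.Adj M} {y y' : ZMod n × Bool}
    (h : G.Adj (c y.1) (c y'.1)) (hy : ¬ Desc z (c y.1)) (hy' : ¬ Desc z (c y'.1)) :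
    Relation.ReflTransGen (FarStep G g (len z + 1)) (z * letter G g y) (z * letter G g y') := by
  have h1 : ¬ Desc (z * letter G g y) (c y'.1) := fun h' => hy' ((desc_mul_of_adj z h _).1 h')
  have h2 := len_mul_letter hg h1
  have h3 := len_mul_letter hg hy
  have h4 := len_mul_letter hg hy'
  refine .trans (.single (b := z * letter G g y * letter G g y') ⟨by omega, by omega, y', rfl⟩)
    (.single (FarStep.symm ⟨by omega, by omega, y, ?_⟩))
  rw [mul_assoc, letter_comm y y' h, mul_assoc]

lemma far_push_out (hc : IsCycle G c) (hn : 4 ≤ n) (hg : ∀ i, g i ≠ 1)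
    {z : GraphProduct V G.Adj M} {y y' : ZMod n × Bool}
    (hy : ¬ Desc z (c y.1)) (hy' : ¬ Desc z (c y'.1)) :
    Relation.ReflTransGen (FarStep G g (len z + 1)) (z * letter G g y) (z * letter G g y') := by
  have same : ∀ (i : ZMod n) (b b' : Bool), ¬ Desc z (c i) →
      Relation.ReflTransGen (FarStep G g (len z + 1)) (z * letter G g (i, b))
        (z * letter G g (i, b')) := by
    intro i b b' hi
    obtain ⟨j, hj, hzj⟩ := hc.exists_adj_not_desc hn z i
    exact .trans (far_of_adj hg (y' := (j, true)) hj hi hzj) (far_of_adj hg hj.symm hzj hi)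
  obtain ⟨d, hd⟩ := exists_arc hn (fun i => Desc z (c i)) (hc.desc z)
  have key : ∀ y : ZMod n × Bool, ¬ Desc z (c y.1) →
      Relation.ReflTransGen (FarStep G g (len z + 1)) (z * letter G g (d, true))
        (z * letter G g y) := by
    rintro ⟨i, b⟩ hi
    obtain ⟨m, rfl, hm⟩ := hd i hi
    clear hi
    induction m generalizing b with
    | zero =>
      have h0 : d + ((0 : ℕ) : ZMod n) = d := by simp
      have := hm 0 le_rfl
      rw [h0] at this ⊢
      exact same _ _ _ this
    | succ m ih =>
      refine (ih true fun m' h => hm m' (by omega)).trans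
        (far_of_adj hg ((hc.2 _ _).2 (Or.inl ?_)) (hm m (by omega)) (hm (m + 1) le_rfl))
      push_cast
      ring
  exact (farStep_symm (key y hy)).trans (key y' hy')

/-- Points at distance at least `r` from the identity can be connected in the complement of
the ball. -/
lemma far_connected (hc : IsCycle G c) (hn : 4 ≤ n) (hg : ∀ i, g i ≠ 1) (r : ℕ)
    {x z : GraphProduct V G.Adj M} (hx : r ≤ len x) (hz : r ≤ len z)
    (hxz : Relation.ReflTransGen (FarStep G g 0) x z) :
    Relation.ReflTransGen (FarStep G g r) x z := by
  induction r with
  | zero => exact hxz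
  | succ r ih =>
    replace ih := ih (by omega) (by omega)
    have key : (r + 1 ≤ len z → Relation.ReflTransGen (FarStep G g (r + 1)) x z) ∧
        (len z = r → ∀ y : ZMod n × Bool, ¬ Desc z (c y.1) →
          Relation.ReflTransGen (FarStep G g (r + 1)) x (z * letter G g y)) := by
      clear hz hxz
      induction ih with
      | refl => exact ⟨fun _ => .refl, fun h => by omega⟩
      | @tail z z' _ hst ih =>
        obtain ⟨h1, h2, y, rfl⟩ := hst
        have hback : z = z * letter G g y * letter G g (y.1, !y.2) := by
          rw [mul_assoc, letter_mul_not, mul_one]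
        by_cases hz : r + 1 ≤ len z
        · have h3 := ih.1 hz
          refine ⟨fun h => h3.tail ⟨hz, h, y, rfl⟩, fun h y' hy' => ?_⟩
          have hd : ¬ Desc (z * letter G g y) (c y.1) := by
            intro hd
            have := len_mul_of_le_of_desc hd (bif !y.2 then (g y.1).1 else (g y.1)⁻¹.1)
            change len (z * letter G g y * letter G g (y.1, !y.2)) ≤ _ at this
            rw [← hback] at this
            omega
          have h4 := far_push_out hc hn hg (y := (y.1, !y.2)) hd hy'
          rw [← hback, h] at h4
          exact h3.trans h4
        · have hzr : len z = r := by omega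
          refine ⟨fun h => ?_, fun h y' hy' => ?_⟩
          · refine ih.2 hzr y fun hd => ?_
            have := len_mul_of_le_of_desc hd (bif y.2 then (g y.1).1 else (g y.1)⁻¹.1)
            change len (z * letter G g y) ≤ _ at this
            omega
          · obtain ⟨j, hj, hzj⟩ := hc.exists_adj_not_desc hn z y.1
            have h3 := ih.2 hzr (j, true) hzj
            have hd : ¬ Desc (z * letter G g y) (c j) :=
              fun h' => hzj ((desc_mul_of_adj z hj _).1 h')
            have h4 := len_mul_letter hg (y := (j, true)) hzj
            have h5 := len_mul_letter hg (y := (j, true)) hd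
            have h6 := far_push_out hc hn hg (y := (j, true)) hd hy'
            rw [h] at h6
            refine (h3.tail ⟨by omega, by omega, y, ?_⟩).trans h6
            rw [mul_assoc, mul_assoc, letter_comm y (j, true) hj]
    exact key.1 hz

lemma exists_word_of_far {r : ℕ} {x z : GraphProduct V G.Adj M} (hx : r ≤ len x)
    (h : Relation.ReflTransGen (FarStep G g r) x z) :
    ∃ w : List (ZMod n × Bool), x * (w.map (letter G g)).prod = z ∧
      ∀ e f, w = e ++ f → r ≤ len (x * (e.map (letter G g)).prod) := by
  induction h with
  | refl =>
    refine ⟨[], by simp, fun e f h => ?_⟩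
    obtain ⟨rfl, rfl⟩ := List.append_eq_nil_iff.1 h.symm
    simpa using hx
  | @tail z z' _ hst ih =>
    obtain ⟨w, hw, hp⟩ := ih
    obtain ⟨-, h2, y, rfl⟩ := hst
    refine ⟨w ++ [y], by simp [← hw, mul_assoc], fun e f h => ?_⟩
    rcases List.append_eq_append_iff.1 h.symm with ⟨s, hs, hs'⟩ | ⟨s, hs, hs'⟩
    · exact hp e s hs
    · rcases s with - | ⟨a, s⟩
      · simp only [List.append_nil] at hs
        exact hp e [] (by simp [hs])
      · simp only [List.cons_append, List.cons.injEq, List.nil_eq, List.append_eq_nil_iff] at hs'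
        obtain ⟨rfl, rfl, rfl⟩ := hs'
        rw [hs]
        simpa [← mul_assoc, hw] using h2

/-- Consecutive letters of a reduced word that never shuffles. -/
def Indep (G : SimpleGraph V) (c : ZMod n → V) (y y' : ZMod n × Bool) : Prop :=
  ¬ G.Adj (c y.1) (c y'.1) ∧ c y.1 ≠ c y'.1

lemma len_of_isChain (hg : ∀ i, g i ≠ 1) (w : List (ZMod n × Bool))
    (hw : w.IsChain (Indep G c)) :
    len (w.map (letter G g)).prod = w.length ∧
      ∀ y, (w ++ [y]).IsChain (Indep G c) → ¬ Desc (w.map (letter G g)).prod (c y.1) := by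
  induction w using List.reverseRecOn with
  | nil => simp [len_one, not_desc_one]
  | append_singleton w y ih =>
    obtain ⟨h1, h2⟩ := ih (hw.left_of_append)
    have h3 := h2 y hw
    simp only [List.map_append, List.map_cons, List.map_nil, List.prod_append, List.prod_cons,
      List.prod_nil, mul_one, List.length_append, List.length_cons, List.length_nil]
    refine ⟨by rw [len_mul_letter hg h3, h1], fun y' hy' => ?_⟩
    have h4 : Indep G c y y' := by
      rw [List.append_assoc] at hy'
      simpa using hy'.right_of_append
    exact not_desc_mul_of h3 (letter_arg_ne_one hg y) h4.1 h4.2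

lemma prod_mul_prod_inv (w : List (ZMod n × Bool)) :
    (w.map (letter G g)).prod *
      ((w.reverse.map fun y => (y.1, !y.2)).map (letter G g)).prod = 1 := by
  induction w with
  | nil => simp
  | cons y w ih =>
    simp only [List.map_cons, List.prod_cons, List.reverse_cons, List.map_append, List.map_nil,
      List.prod_append, List.prod_nil, mul_one]
    rw [mul_assoc, ← mul_assoc _ _ (letter G g _), ih, one_mul, letter_mul_not]

lemma far_zero (z : GraphProduct V G.Adj M) (w : List (ZMod n × Bool)) :
    Relation.ReflTransGen (FarStep G g 0) z (z * (w.map (letter G g)).prod) := by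
  induction w generalizing z with
  | nil => simpa using .refl
  | cons y w ih =>
    refine .head (b := z * letter G g y) ⟨Nat.zero_le _, Nat.zero_le _, y, rfl⟩ ?_
    rw [List.map_cons, List.prod_cons, ← mul_assoc]
    exact ih _

theorem not_isCycle_of_units (h : CFM (GraphProduct V G.Adj M)) (hc : IsCycle G c) (hn : 4 ≤ n)
    (hg : ∀ i, g i ≠ 1) : False := by
  have : NeZero n := ⟨by omega⟩
  obtain ⟨F, hF, htri⟩ := CF.exists_triangle (φ := letter G g)
    (fun y => ((g y.1).map (of G.Adj (c y.1))).isUnit.elim fun u hu => by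
      obtain ⟨i, b⟩ := y
      cases b
      · exact ((g i)⁻¹.map (of G.Adj (c i))).isUnit
      · exact ((g i).map (of G.Adj (c i))).isUnit)
    (h (ZMod n × Bool) inferInstance (letter G g))
  obtain ⟨R, hR⟩ := (hF.image len).bddAbove
  have hfin := (List.finite_length_le (ZMod n × Bool) R).image2
    (fun w k => len ((w.map (letter G g)).prod * k)) hF
  obtain ⟨r, hr⟩ := hfin.bddAbove
  let A : ℕ → ZMod n × Bool := fun i => (if i % 2 = 0 then 0 else 2, true)
  let W : List (ZMod n × Bool) := (List.range ((r + 2) + (r + 2))).map A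
  have hI : ∀ y y' : ZMod n × Bool, Indep G c y y' → Indep G c y' y :=
    fun y y' h => ⟨fun h' => h.1 h'.symm, h.2.symm⟩
  have h02 : ∀ b b', Indep G c (0, b) (2, b') := by
    intro b b'
    have h1 := not_cycle_adj hn (0 : ZMod n)
    rw [zero_add] at h1
    push Not at h1
    refine ⟨fun h => ?_, fun h => h1.1 (hc.1 h)⟩
    rcases (hc.2 _ _).1 h with h | h
    · exact h1.2.1 h
    · exact h1.2.2 h
  have hA : ∀ i, Indep G c (A i) (A (i + 1)) := by
    intro i
    rcases Nat.mod_two_eq_zero_or_one i with hi | hi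
    · have : (i + 1) % 2 ≠ 0 := by omega
      simp only [A, hi, this, if_true, if_false]
      exact h02 _ _
    · have h0 : i % 2 ≠ 0 := by omega
      have : (i + 1) % 2 = 0 := by omega
      simp only [A, h0, this, if_true, if_false]
      exact hI _ _ (h02 _ _)
  have hW : W.IsChain (Indep G c) := by
    rw [List.isChain_iff_getElem]
    intro i hi
    simpa [W] using hA i
  set w₁ := W.take (r + 2) with hw₁
  set w₂ := W.drop (r + 2) with hw₂
  have hW12 : W = w₁ ++ w₂ := (List.take_append_drop _ _).symm
  have hl₁ : w₁.length = r + 2 := by simp [w₁, W]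
  have hl₂ : w₂.length = r + 2 := by simp [w₂, W]
  have hc₁ : w₁.IsChain (Indep G c) := (hW12 ▸ hW).left_of_append
  have hc₂ : w₂.IsChain (Indep G c) := (hW12 ▸ hW).right_of_append
  let inv (w : List (ZMod n × Bool)) := w.reverse.map fun y => (y.1, !y.2)
  have hinv : (inv w₁).IsChain (Indep G c) := by
    rw [List.isChain_map, List.isChain_reverse]
    exact hc₁.imp fun y y' h => hI _ _ h
  have hy := (len_of_isChain hg w₂ hc₂).1
  have hx := (len_of_isChain hg (inv w₁) hinv).1
  have hlinv : (inv w₁).length = r + 2 := by simp [inv, hl₁]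
  have hreach := far_zero (g := g) (w₂.map (letter G g)).prod (inv w₂ ++ inv w₁)
  rw [List.map_append, List.prod_append, ← mul_assoc, prod_mul_prod_inv, one_mul] at hreach
  obtain ⟨w₃, hw₃, hpre⟩ := exists_word_of_far (by omega)
    (far_connected hc hn hg (r + 1) (by omega) (by omega) hreach)
  obtain ⟨l, b, c', d, e, f, h1, h2, h3, h4, h5⟩ := htri w₁ w₂ w₃ (by omega) (by
    rw [List.map_append, List.map_append, List.prod_append, List.prod_append, mul_assoc, hw₃,
      prod_mul_prod_inv])
  have hbc : (b ++ c').IsChain (Indep G c) := by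
    have : W = l ++ ((b ++ c') ++ d) := by rw [hW12, h1, h2]; simp
    rw [this] at hW
    exact hW.right_of_append.left_of_append
  have h6 := hR ⟨_, h4, rfl⟩
  rw [(len_of_isChain hg _ hbc).1, List.length_append] at h6
  have h7 := hr ⟨c', show c'.length ≤ R by omega, _, h5, rfl⟩
  have h8 := hpre e f h3
  simp only [h2, List.map_append, List.prod_append, mul_assoc] at h7 h8
  omega

end Cycle

end GraphProduct

/-! ### Necessity -/

open GraphProduct in
theorem necessity {V : Type} (G : SimpleGraph V) (M : V → Type) [∀ v, Monoid (M v)]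
    (hJ : ∀ v, ∃ a : M v, a ≠ 1 ∧ a ∈ Jset (M v)) (h : CFM (GraphProduct V G.Adj M)) :
    (∀ v, CFM (M v)) ∧
       (∀ v w, ¬ IsFRI (M v) → ¬ IsFRI (M w) → v ≠ w → ¬ G.Adj v w) ∧
       (∀ u v w, ¬ IsFRI (M v) → IsFRI (M u) → IsFRI (M w) →
          G.Adj v u → G.Adj v w → u ≠ w → G.Adj u w) ∧
       Chordal V G.Adj := by
  refine ⟨fun v => h.of_injective _ (of_injective (fun v => G.loopless.irrefl v) v), ?_, ?_, ?_⟩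
  · intro v w hv hw _ hvw
    exact not_dyckOn_join h (S := {v}) (S' := {w}) (by simpa using hvw)
      (dyckOn_of_not_isFRI hv rfl) (dyckOn_of_not_isFRI hw rfl)
  · intro u v w hv _ _ hvu hvw hne
    by_contra huw
    exact not_dyckOn_join h (S := {v}) (S' := {u, w}) (by simpa using ⟨hvu, hvw⟩)
      (dyckOn_of_not_isFRI hv rfl) (dyckOn_pair huw hne (hJ u) (hJ w))
  · rintro ⟨n, hn, c, hc⟩
    by_cases hF : ∀ i, IsFRI (M (c i))
    · choose a ha haJ using fun i => hJ (c i)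
      choose g hg using fun i => (hF i).isUnit_of_mem_Jset (haJ i)
      refine not_isCycle_of_units (g := g) h hc hn fun i hi => ha i ?_
      rw [← hg, hi, Units.val_one]
    · push Not at hF
      obtain ⟨i, hi⟩ := hF
      have h1 := not_cycle_adj hn (i - 1)
      have h2 : i - 1 + 2 = i + 1 := by ring
      rw [h2] at h1
      push Not at h1
      refine not_dyckOn_join h (S := {c i}) (S' := {c (i - 1), c (i + 1)}) ?_
        (dyckOn_of_not_isFRI hi rfl) (dyckOn_pair (fun h => ?_) (fun h => h1.1 (hc.1 h))
          (hJ _) (hJ _))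
      · simp [hc.2]
      · rcases (hc.2 _ _).1 h with h | h
        · exact h1.2.1 h
        · exact h1.2.2 h

/-! ### A product of two monoids amalgamated over a group -/

/-- `P` is the quotient of the free product of `A` and `N` by the commutation of `A` with the
image of `ι`, where `ι` embeds a group as a retract of `N`. -/
structure IsAmalgam {A N K P : Type} [Monoid A] [Monoid N] [Group K] [Monoid P]
    (ι : K →* N) (ρ : N →* K) (jA : A →* P) (jN : N →* P) : Prop where
  retract : ∀ k, ρ (ι k) = k
  commute : ∀ a k, Commute (jA a) (jN (ι k))
  closure : Submonoid.closure (Set.range jA ∪ Set.range jN) = ⊤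
  lift : ∀ {Q : Type} [Monoid Q] (f : A →* Q) (f' : N →* Q),
    (∀ a k, Commute (f a) (f' (ι k))) → ∃ F : P →* Q, (∀ a, F (jA a) = f a) ∧ ∀ x, F (jN x) = f' x

namespace Amalgam

variable {A N K : Type} [Monoid A] [Monoid N] [Group K] (ι : K →* N) (ρ : N →* K)

/-- Normal forms: a first entry of `A`, a stack of pairs, and a last entry of `N`. -/
abbrev State (A : Type) [Monoid A] (ρ : N →* K) : Type :=
  A × List ({t : N // ρ t = 1 ∧ t ≠ 1} × {a : A // a ≠ 1}) × N

variable (A) in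
/-- The right action of `N` on normal forms. -/
def actN (x : N) : State A ρ → State A ρ
  | (a₀, s, m) => (a₀, s, m * x)

variable {ρ} {ι}

lemma mul_inv_spec (hρ : ∀ k, ρ (ι k) = k) {m : N} (h : m ≠ ι (ρ m)) :
    ρ (m * ι (ρ m)⁻¹) = 1 ∧ m * ι (ρ m)⁻¹ ≠ 1 := by
  refine ⟨by rw [map_mul, hρ, mul_inv_cancel], fun h' => h ?_⟩
  refine ((Group.isUnit (ρ m)⁻¹).map ι).mul_right_cancel ?_
  rw [h', ← map_mul, mul_inv_cancel, map_one]

open Classical in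
/-- The right action of `A` on normal forms. -/
noncomputable def actA (hρ : ∀ k, ρ (ι k) = k) (a : A) : State A ρ → State A ρ
  | (a₀, s, m) =>
    if h : m = ι (ρ m) then
      match s with
      | [] => (a₀ * a, [], m)
      | (t, a') :: s =>
        if h : a'.1 * a = 1 then (a₀, s, t.1 * m) else (a₀, (t, ⟨a'.1 * a, h⟩) :: s, m)
    else if h' : a = 1 then (a₀, s, m)
    else (a₀, (⟨m * ι (ρ m)⁻¹, mul_inv_spec hρ h⟩, ⟨a, h'⟩) :: s, ι (ρ m))

section

variable (hρ : ∀ k, ρ (ι k) = k) (a b : A) (a₀ : A)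
  (s : List ({t : N // ρ t = 1 ∧ t ≠ 1} × {a : A // a ≠ 1})) {m : N}

lemma actA_nil (h : m = ι (ρ m)) : actA hρ a (a₀, [], m) = (a₀ * a, [], m) := by
  simp only [actA, dif_pos h]

lemma actA_pop (t a') (h : m = ι (ρ m)) (h' : a'.1 * a = 1) :
    actA hρ a (a₀, (t, a') :: s, m) = (a₀, s, t.1 * m) := by
  simp only [actA, dif_pos h, dif_pos h']

lemma actA_merge (t a') (h : m = ι (ρ m)) (h' : a'.1 * a ≠ 1) :
    actA hρ a (a₀, (t, a') :: s, m) = (a₀, (t, ⟨a'.1 * a, h'⟩) :: s, m) := by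
  simp only [actA, dif_pos h, dif_neg h']

lemma actA_one_of_ne (h : m ≠ ι (ρ m)) : actA hρ 1 (a₀, s, m) = (a₀, s, m) := by
  simp only [actA, dif_neg h, dif_pos]

lemma actA_push (h : m ≠ ι (ρ m)) (h' : a ≠ 1) : actA hρ a (a₀, s, m) =
    (a₀, (⟨m * ι (ρ m)⁻¹, mul_inv_spec hρ h⟩, ⟨a, h'⟩) :: s, ι (ρ m)) := by
  simp only [actA, dif_neg h, dif_neg h']

lemma mul_ne (t : {t : N // ρ t = 1 ∧ t ≠ 1}) (h : m = ι (ρ m)) :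
    t.1 * m ≠ ι (ρ (t.1 * m)) := by
  intro h'
  rw [map_mul, t.2.1, one_mul] at h'
  refine t.2.2 ?_
  refine ((Group.isUnit (ρ m)).map ι).mul_right_cancel ?_
  rw [← h, one_mul, h', ← h]

lemma actA_one : actA (A := A) hρ 1 = id := by
  funext ⟨a₀, s, m⟩
  by_cases h : m = ι (ρ m)
  · rcases s with - | ⟨⟨t, a'⟩, s⟩
    · rw [actA_nil hρ _ _ h, mul_one, id]
    · rw [actA_merge hρ _ _ _ _ _ h (by rw [mul_one]; exact a'.2)]
      simp
  · exact actA_one_of_ne hρ _ _ h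

lemma actA_mul (x : State A ρ) : actA hρ (a * b) x = actA hρ b (actA hρ a x) := by
  obtain ⟨a₀, s, m⟩ := x
  by_cases h : m = ι (ρ m)
  · rcases s with - | ⟨⟨t, a'⟩, s⟩
    · rw [actA_nil hρ _ _ h, actA_nil hρ _ _ h, actA_nil hρ _ _ h, mul_assoc]
    · by_cases h1 : a'.1 * a = 1
      · rw [actA_pop hρ _ _ _ _ _ h h1]
        have h2 := mul_ne t h
        by_cases hb : b = 1
        · subst hb
          rw [actA_one_of_ne hρ _ _ h2, mul_one, actA_pop hρ _ _ _ _ _ h h1]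
        · have h3 : a'.1 * (a * b) ≠ 1 := by rwa [← mul_assoc, h1, one_mul]
          rw [actA_push hρ _ _ _ h2 hb, actA_merge hρ _ _ _ _ _ h h3]
          have h4 : ι (ρ (t.1 * m)) = m := by rw [map_mul, t.2.1, one_mul, ← h]
          have h5 : t.1 * m * ι (ρ (t.1 * m))⁻¹ = t.1 := by
            rw [map_mul ρ, t.2.1, one_mul, mul_assoc]
            nth_rewrite 1 [h]
            rw [← map_mul, mul_inv_cancel, map_one, mul_one]
          simp only [h4, h5, ← mul_assoc, h1, one_mul]
      · rw [actA_merge hρ _ _ _ _ _ h h1]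
        by_cases h2 : a'.1 * a * b = 1
        · rw [actA_pop hρ b _ _ _ _ h h2, actA_pop hρ _ _ _ _ _ h (by rwa [← mul_assoc])]
        · rw [actA_merge hρ b _ _ _ _ h h2, actA_merge hρ _ _ _ _ _ h (by rwa [← mul_assoc])]
          simp only [mul_assoc]
  · have hm : ι (ρ m) = ι (ρ (ι (ρ m))) := by rw [hρ]
    by_cases ha : a = 1
    · subst ha
      rw [actA_one_of_ne hρ _ _ h, one_mul]
    · rw [actA_push hρ _ _ _ h ha]
      by_cases hab : a * b = 1
      · rw [actA_pop hρ _ _ _ _ _ hm hab, hab, actA_one_of_ne hρ _ _ h, mul_assoc, ← map_mul,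
          inv_mul_cancel, map_one, mul_one]
      · rw [actA_merge hρ _ _ _ _ _ hm hab, actA_push hρ _ _ _ h hab]

lemma actA_actN (k : K) (x : State A ρ) :
    actA hρ a (actN A ρ (ι k) x) = actN A ρ (ι k) (actA hρ a x) := by
  obtain ⟨a₀, s, m⟩ := x
  have hk : ι (ρ (m * ι k)) = ι (ρ m) * ι k := by rw [map_mul, map_mul, hρ]
  change actA hρ a (a₀, s, m * ι k) = _
  by_cases h : m = ι (ρ m)
  · have h' : m * ι k = ι (ρ (m * ι k)) := by rw [hk, ← h]
    rcases s with - | ⟨⟨t, a'⟩, s⟩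
    · rw [actA_nil hρ _ _ h, actA_nil hρ _ _ h']
      rfl
    · by_cases h1 : a'.1 * a = 1
      · rw [actA_pop hρ _ _ _ _ _ h h1, actA_pop hρ _ _ _ _ _ h' h1]
        simp only [actN, mul_assoc]
      · rw [actA_merge hρ _ _ _ _ _ h h1, actA_merge hρ _ _ _ _ _ h' h1]
        rfl
  · have h' : m * ι k ≠ ι (ρ (m * ι k)) := by
      intro h'
      rw [hk] at h'
      exact h (((Group.isUnit k).map ι).mul_right_cancel h')
    by_cases ha : a = 1
    · subst ha
      rw [actA_one_of_ne hρ _ _ h, actA_one_of_ne hρ _ _ h']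
      rfl
    · rw [actA_push hρ _ _ _ h ha, actA_push hρ _ _ _ h' ha]
      have : m * ι k * ι (ρ (m * ι k))⁻¹ = m * ι (ρ m)⁻¹ := by
        rw [map_mul ρ, hρ, mul_inv_rev, map_mul, ← mul_assoc, mul_assoc m, ← map_mul ι k,
          mul_inv_cancel, map_one, mul_one]
      simp only [this, hk, actN]

end

/-- If a word represents `1`, then its action on normal forms is trivial. -/
lemma foldl_eq_self {P : Type} [Monoid P] {jA : A →* P} {jN : N →* P}
    (H : IsAmalgam ι ρ jA jN) (l : List (A ⊕ N))
    (hl : (l.map (Sum.elim jA jN)).prod = 1) (x : State A ρ) :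
    l.foldl (fun x y => Sum.elim (fun a => actA H.retract a x) (fun b => actN A ρ b x) y) x
      = x := by
  let fA : A →* (Function.End (State A ρ))ᵐᵒᵖ :=
    { toFun := fun a => MulOpposite.op (actA H.retract a)
      map_one' := congrArg MulOpposite.op (actA_one H.retract)
      map_mul' := fun a b => congrArg MulOpposite.op (funext (actA_mul H.retract a b)) }
  let fN : N →* (Function.End (State A ρ))ᵐᵒᵖ :=
    { toFun := fun a => MulOpposite.op (actN A ρ a)
      map_one' := congrArg MulOpposite.op (funext fun x => by simp [actN]; rfl)
      map_mul' := fun a b => congrArg MulOpposite.op (funext fun x => by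
        change _ = actN A ρ b (actN A ρ a x)
        simp [actN, mul_assoc]) }
  obtain ⟨F, hFA, hFN⟩ := H.lift fA fN fun a k =>
    congrArg MulOpposite.op (funext fun x => (actA_actN H.retract a k x).symm)
  have key : ∀ (l : List (A ⊕ N)) (x : State A ρ),
      l.foldl (fun x y => Sum.elim (fun a => actA H.retract a x) (fun b => actN A ρ b x) y) x
        = (F (l.map (Sum.elim jA jN)).prod).unop x := by
    intro l
    induction l with
    | nil => intro x; simp; rfl
    | cons y l ih =>
      intro x
      rw [List.foldl_cons, ih, List.map_cons, List.prod_cons, map_mul, MulOpposite.unop_mul]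
      rcases y with a | b
      · simp only [Sum.elim_inl, hFA]; rfl
      · simp only [Sum.elim_inr, hFN]; rfl
  rw [key, hl, map_one]
  rfl

end Amalgam

namespace Amalgam

variable {A N K : Type} [Monoid A] [Monoid N] [Group K] (ι : K →* N) {κ : Submonoid K}
  {Y : Type} (ψ : Y → A ⊕ N)

/-- Nonterminals: `inl k` produces words over the whole alphabet and with value `ι k` that
begin and end on the `N` side, `inr k` produces those that begin and end on the `A` side. -/
abbrev Sym (Y : Type) (κ : Submonoid K) : Type := Y ⊕ (κ ⊕ κ)

/-- Value in `N` of a letter of a word on the `N` side. -/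
def valN : Sym Y κ → N
  | Sum.inl y => Sum.elim (fun _ => 1) id (ψ y)
  | Sum.inr (Sum.inl _) => 1
  | Sum.inr (Sum.inr k) => ι k

/-- Letters of the words on the `N` side. -/
def OkN : Sym Y κ → Prop
  | Sum.inl y => (ψ y).isRight
  | Sum.inr (Sum.inl _) => False
  | Sum.inr (Sum.inr _) => True

/-- Value in `A` of a letter of a word on the `A` side. -/
def valA : Sym Y κ → A
  | Sum.inl y => Sum.elim id (fun _ => 1) (ψ y)
  | Sum.inr _ => 1

/-- Value in `κ` of a letter of a word on the `A` side. -/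
def valK : Sym Y κ → κ
  | Sum.inl _ => 1
  | Sum.inr (Sum.inl k) => k
  | Sum.inr (Sum.inr _) => 1

/-- Letters of the words on the `A` side. -/
def OkA : Sym Y κ → Prop
  | Sum.inl y => (ψ y).isLeft
  | Sum.inr (Sum.inl _) => True
  | Sum.inr (Sum.inr _) => False

/-- The productions. -/
def Prod : κ ⊕ κ → List (Sym Y κ) → Prop
  | Sum.inl k, α => (∀ t ∈ α, OkN ψ t) ∧ (α.map (valN ι ψ)).prod = ι k
  | Sum.inr k, α => (∀ t ∈ α, OkA ψ t) ∧ (α.map (valA ψ)).prod = 1 ∧ (α.map valK).prod = k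

lemma path_iff {T R : Type} [Monoid R] (ok : T → Prop) (f : T → R) (a b : R) (w : List T) :
    Path (fun p t q => ok t ∧ q = p * f t) a w b ↔
      (∀ t ∈ w, ok t) ∧ a * (w.map f).prod = b := by
  induction w generalizing a with
  | nil =>
    constructor
    · rintro ⟨⟩; simp
    · rintro ⟨-, h⟩
      simp only [List.map_nil, List.prod_nil, mul_one] at h
      exact h ▸ .nil a
  | cons t w ih =>
    rw [List.forall_mem_cons, List.map_cons, List.prod_cons, ← mul_assoc]
    constructor
    · rintro (_ | ⟨⟨h1, rfl⟩, h2⟩)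
      exact ⟨⟨h1, ((ih _).1 h2).1⟩, ((ih _).1 h2).2⟩
    · rintro ⟨⟨h1, h2⟩, h3⟩
      exact .cons ⟨h1, rfl⟩ ((ih _).2 ⟨h2, h3⟩)

lemma cf_prod [Finite Y] [Finite κ] (hA : CFM A) (hN : CFM N) (i : κ ⊕ κ) :
    CF (Prod ι ψ i) := by
  rcases i with k | k
  · have h1 : ι k * ι (k : K)⁻¹ = 1 := by rw [← map_mul, mul_inv_cancel, map_one]
    have h2 : ι (k : K)⁻¹ * ι k = 1 := by rw [← map_mul, inv_mul_cancel, map_one]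
    refine ((hN.value (valN (κ := κ) ι ψ) h1 h2).inter
      (fun (p : PUnit) t (q : PUnit) => OkN ψ t ∧ q = p * 1) 1 1).congr fun w => ?_
    rw [path_iff (OkN ψ) (fun _ => (1 : PUnit))]
    simp [Prod, and_comm]
  · refine ((hA _ inferInstance (valA (κ := κ) ψ)).inter
      (fun (p : κ) t (q : κ) => OkA ψ t ∧ q = p * valK t) 1 k).congr fun w => ?_
    rw [path_iff (OkA ψ) valK]
    simp only [Prod, one_mul]
    tauto

section Soundness

variable {ι} {ψ} {ρ : N →* K} {P : Type} [Monoid P] {jA : A →* P} {jN : N →* P}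

lemma prod_eq_of_subst (H : IsAmalgam ι ρ jA jN) {α : List (Sym Y κ)} {w : List Y}
    (h : Subst (Prod ι ψ) α w) :
    ((∀ t ∈ α, OkN ψ t) →
      (w.map fun y => Sum.elim jA jN (ψ y)).prod = jN (α.map (valN ι ψ)).prod) ∧
    ((∀ t ∈ α, OkA ψ t) → (w.map fun y => Sum.elim jA jN (ψ y)).prod =
      jA (α.map (valA ψ)).prod * jN (ι (α.map valK).prod)) := by
  induction h with
  | nil => simp
  | @term α w t _ ih =>
    simp only [List.forall_mem_cons, List.map_cons, List.prod_cons]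
    constructor
    · rintro ⟨h1, h2⟩
      rw [ih.1 h2, map_mul]
      replace h1 : (ψ t).isRight := h1
      change _ = jN (Sum.elim (fun _ => 1) id (ψ t)) * _
      generalize ψ t = x at h1 ⊢
      rcases x with a | b
      · simp at h1
      · rfl
    · rintro ⟨h1, h2⟩
      rw [ih.2 h2, map_mul, ← mul_assoc]
      replace h1 : (ψ t).isLeft := h1
      change _ = jA (Sum.elim id (fun _ => 1) (ψ t)) * _ * jN (ι ↑(1 * _))
      generalize ψ t = x at h1 ⊢
      rcases x with a | b
      · simp
      · simp at h1
  | @nonterm j β u α w hj _ _ ihu ihw =>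
    simp only [List.forall_mem_cons, List.map_cons, List.prod_cons, List.map_append,
      List.prod_append]
    rcases j with k | k
    · refine ⟨fun h => h.1.elim, fun h => ?_⟩
      rw [ihw.2 h.2, ihu.1 hj.1, hj.2]
      simp only [valA, valK, one_mul, Submonoid.coe_mul, map_mul, ← mul_assoc]
      rw [(H.commute _ _).eq]
    · refine ⟨fun h => ?_, fun h => h.1.elim⟩
      rw [ihw.1 h.2, ihu.2 hj.1, hj.2.1, hj.2.2, map_one, one_mul, map_mul]
      rfl

end Soundness

section Completeness

variable {ι} {ψ} {ρ : N →* K}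

variable (ι κ ψ) in
/-- `w` is produced by a word on the `N` side with value `m`. -/
def DerN (m : N) (w : List Y) : Prop :=
  ∃ α : List (Sym Y κ), (∀ t ∈ α, OkN ψ t) ∧ (α.map (valN ι ψ)).prod = m ∧ Subst (Prod ι ψ) α w

variable (ι ψ) in
/-- `w` is produced by a word on the `A` side with values `a` and `k`. -/
def DerA (a : A) (k : κ) (w : List Y) : Prop :=
  ∃ α : List (Sym Y κ), (∀ t ∈ α, OkA ψ t) ∧ (α.map (valA ψ)).prod = a ∧
    (α.map valK).prod = k ∧ Subst (Prod ι ψ) α w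

lemma DerN.nil : DerN ι κ ψ 1 [] := ⟨[], by simp, by simp, .nil⟩

lemma DerA.nil : DerA ι ψ 1 (1 : κ) [] := ⟨[], by simp, by simp, by simp, .nil⟩

lemma DerN.append {m m' : N} {w w' : List Y} (h : DerN ι κ ψ m w) (h' : DerN ι κ ψ m' w') :
    DerN ι κ ψ (m * m') (w ++ w') := by
  obtain ⟨α, h1, rfl, h2⟩ := h
  obtain ⟨β, h1', rfl, h2'⟩ := h'
  exact ⟨α ++ β, fun t ht => (List.mem_append.1 ht).elim (h1 t) (h1' t), by simp, h2.append h2'⟩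

lemma DerA.append {a a' : A} {k k' : κ} {w w' : List Y} (h : DerA ι ψ a k w)
    (h' : DerA ι ψ a' k' w') : DerA ι ψ (a * a') (k * k') (w ++ w') := by
  obtain ⟨α, h1, rfl, rfl, h2⟩ := h
  obtain ⟨β, h1', rfl, rfl, h2'⟩ := h'
  exact ⟨α ++ β, fun t ht => (List.mem_append.1 ht).elim (h1 t) (h1' t), by simp, by simp,
    h2.append h2'⟩

lemma DerN.letter {y : Y} {x : N} (h : ψ y = Sum.inr x) : DerN ι κ ψ x [y] :=
  ⟨[Sum.inl y], by simp [OkN, h], by simp [valN, h], .term y .nil⟩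

lemma DerA.letter {y : Y} {x : A} (h : ψ y = Sum.inl x) : DerA ι ψ x (1 : κ) [y] :=
  ⟨[Sum.inl y], by simp [OkA, h], by simp [valA, h], by simp [valK], .term y .nil⟩

lemma DerN.toA {k : κ} {w : List Y} (h : DerN ι κ ψ (ι k) w) : DerA ι ψ 1 k w := by
  obtain ⟨α, h1, h2, h3⟩ := h
  refine ⟨[Sum.inr (Sum.inl k)], by simp [OkA], by simp [valA], by simp [valK], ?_⟩
  simpa using Subst.nonterm (L := Prod ι ψ) (j := Sum.inl k) ⟨h1, h2⟩ h3 .nil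

lemma DerA.toN {k : κ} {w : List Y} (h : DerA ι ψ 1 k w) : DerN ι κ ψ (ι k) w := by
  obtain ⟨α, h1, h2, h2', h3⟩ := h
  refine ⟨[Sum.inr (Sum.inr k)], by simp [OkN], by simp [valN], ?_⟩
  simpa using Subst.nonterm (L := Prod ι ψ) (j := Sum.inr k) ⟨h1, h2, h2'⟩ h3 .nil

lemma DerN.mem (hρ : ∀ k, ρ (ι k) = k) (hκ : ∀ y x, ψ y = Sum.inr x → ρ x ∈ κ) {m : N} {w : List Y}
    (h : DerN ι κ ψ m w) : ρ m ∈ κ := by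
  obtain ⟨α, h1, rfl, -⟩ := h
  induction α with
  | nil => simp
  | cons t α ih =>
    rw [List.forall_mem_cons] at h1
    rw [List.map_cons, List.prod_cons, map_mul]
    refine mul_mem ?_ (ih h1.2)
    rcases t with y | k | k
    · simp only [valN]
      rcases hy : ψ y with a | b
      · simp
      · exact hκ y b hy
    · simp [valN]
    · simp [valN, hρ]

variable (ι κ ψ) in
/-- The state reached after reading `w`. -/
def Inv (a₀ : A) : List ({t : N // ρ t = 1 ∧ t ≠ 1} × {a : A // a ≠ 1}) → N → List Y → Prop
  | [], m, w => ∃ (k : κ) (m' : N) (u v : List Y), w = u ++ v ∧ DerA ι ψ a₀ k u ∧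
      DerN ι κ ψ m' v ∧ ι k * m' = m
  | (t, a) :: s, m, w => ∃ (k₀ k : κ) (m' : N) (r u v : List Y), w = r ++ (u ++ v) ∧
      Inv a₀ s (t.1 * ι k₀) r ∧ DerA ι ψ a.1 k u ∧ DerN ι κ ψ m' v ∧ ι (k₀ * k) * m' = m

variable {a₀ : A} {s : List ({t : N // ρ t = 1 ∧ t ≠ 1} × {a : A // a ≠ 1})} {m m' : N}
  {w w' : List Y}

lemma Inv.append (h : Inv ι κ ψ a₀ s m w) (h' : DerN ι κ ψ m' w') :
    Inv ι κ ψ a₀ s (m * m') (w ++ w') := by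
  rcases s with - | ⟨t, a⟩
  · obtain ⟨k, m₁, u, v, rfl, h1, h2, rfl⟩ := h
    exact ⟨k, m₁ * m', u, v ++ w', by simp, h1, h2.append h', by simp [mul_assoc]⟩
  · obtain ⟨k₀, k, m₁, r, u, v, rfl, h0, h1, h2, rfl⟩ := h
    exact ⟨k₀, k, m₁ * m', r, u, v ++ w', by simp, h0, h1, h2.append h', by simp [mul_assoc]⟩

lemma Inv.mem (hρ : ∀ k, ρ (ι k) = k) (hκ : ∀ y x, ψ y = Sum.inr x → ρ x ∈ κ)
    (h : Inv ι κ ψ a₀ s m w) : ρ m ∈ κ := by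
  rcases s with - | ⟨t, a⟩
  · obtain ⟨k, m₁, u, v, -, -, h2, rfl⟩ := h
    rw [map_mul, hρ]
    exact mul_mem k.2 (h2.mem hρ hκ)
  · obtain ⟨k₀, k, m₁, r, u, v, rfl, -, -, h2, rfl⟩ := h
    rw [map_mul, hρ]
    exact mul_mem (mul_mem k₀.2 k.2) (h2.mem hρ hκ)

lemma eq_of_mul_eq (hρ : ∀ k, ρ (ι k) = k) {k : K} (h : ι k * m = ι (ρ (ι k * m))) :
    m = ι (ρ m) := by
  rw [map_mul, hρ, map_mul] at h
  exact ((Group.isUnit k).map ι).mul_left_cancel h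

lemma Inv.step (hρ : ∀ k, ρ (ι k) = k) (hκ : ∀ y x, ψ y = Sum.inr x → ρ x ∈ κ) {x : State A ρ}
    (h : Inv ι κ ψ x.1 x.2.1 x.2.2 w) (y : Y) :
    let x' := Sum.elim (fun a => actA hρ a x) (fun b => actN A ρ b x) (ψ y)
    Inv ι κ ψ x'.1 x'.2.1 x'.2.2 (w ++ [y]) := by
  obtain ⟨a₀, s, m⟩ := x
  simp only at h
  rcases hy : ψ y with b | x
  swap
  · exact h.append (.letter hy)
  simp only [Sum.elim_inl]
  have hb : DerA ι ψ b (1 : κ) [y] := .letter hy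
  by_cases hm : m = ι (ρ m)
  · rcases s with - | ⟨⟨t, a⟩, s⟩
    · rw [actA_nil hρ _ _ hm]
      obtain ⟨k, m', u, v, rfl, h1, h2, rfl⟩ := h
      have hm' := eq_of_mul_eq hρ hm
      have h3 := h2
      rw [hm'] at h3
      have h4 := h1.append ((DerN.toA (k := ⟨ρ m', h2.mem hρ hκ⟩) h3).append hb)
      rw [one_mul, mul_one] at h4
      refine ⟨_, 1, _, [], by simp, h4, .nil, ?_⟩
      simp only [mul_one, Submonoid.coe_mul, map_mul, ← hm']
    · obtain ⟨k₀, k, m', r, u, v, rfl, h0, h1, h2, rfl⟩ := h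
      have hm' := eq_of_mul_eq hρ hm
      have h3 := h2
      rw [hm'] at h3
      have h4 := h1.append ((DerN.toA (k := ⟨ρ m', h2.mem hρ hκ⟩) h3).append hb)
      rw [one_mul, mul_one] at h4
      by_cases hab : a.1 * b = 1
      · rw [actA_pop hρ _ _ _ _ _ hm hab]
        rw [hab] at h4
        have h5 := h0.append h4.toN
        simp only [Submonoid.coe_mul, map_mul, ← hm', mul_assoc, List.append_assoc] at h5 ⊢
        exact h5
      · rw [actA_merge hρ _ _ _ _ _ hm hab]
        refine ⟨k₀, _, 1, r, _, [], by simp, h0, h4, .nil, ?_⟩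
        simp only [mul_one, Submonoid.coe_mul, map_mul, ← hm', mul_assoc]
  · by_cases h1 : b = 1
    · subst h1
      rw [actA_one_of_ne hρ _ _ hm]
      simpa using h.append hb.toN
    · rw [actA_push hρ _ _ _ hm h1]
      refine ⟨⟨ρ m, h.mem hρ hκ⟩, 1, 1, w, [y], [], by simp, ?_, hb, .nil, by simp⟩
      simp only
      rwa [mul_assoc, ← map_mul, inv_mul_cancel, map_one, mul_one]

end Completeness

end Amalgam

open Amalgam in
/-- The amalgam of two context-free monoids over a locally finite group is context-free. -/
theorem CFM.amalgam {A N K P : Type} [Monoid A] [Monoid N] [Group K] [Monoid P] {ι : K →* N}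
    {ρ : N →* K} {jA : A →* P} {jN : N →* P} (H : IsAmalgam ι ρ jA jN) (hA : CFM A)
    (hN : CFM N) (hK : ∀ F : Set K, F.Finite → (Submonoid.closure F : Set K).Finite) : CFM P := by
  refine .of_closure _ (Or.inl ⟨1, map_one _⟩) H.closure fun Y _ φ hφ => ?_
  have hψ : ∀ y, ∃ x : A ⊕ N, φ y = Sum.elim jA jN x := by
    intro y
    obtain ⟨a, ha⟩ | ⟨b, hb⟩ := hφ y
    · exact ⟨Sum.inl a, ha.symm⟩
    · exact ⟨Sum.inr b, hb.symm⟩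
  choose ψ hψ using hψ
  obtain rfl : φ = fun y => Sum.elim jA jN (ψ y) := funext hψ
  let S : Set K := Set.range fun y => Sum.elim (fun _ => 1) ρ (ψ y)
  let κ := Submonoid.closure S
  have : Finite κ := (hK S (Set.finite_range _)).to_subtype
  have hκ : ∀ y x, ψ y = Sum.inr x → ρ x ∈ κ :=
    fun y x h => Submonoid.subset_closure ⟨y, by simp [h]⟩
  refine (CF.iterate (cf_prod (κ := κ) ι ψ hA hN) (Sum.inl 1)).congr fun w => ⟨fun h => ?_, ?_⟩
  · have key : ∀ (v u : List Y) (x : State A ρ), Inv ι κ ψ x.1 x.2.1 x.2.2 u →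
        let x' := v.foldl (fun x y => Sum.elim (fun a => actA H.retract a x)
          (fun b => actN A ρ b x) (ψ y)) x
        Inv ι κ ψ x'.1 x'.2.1 x'.2.2 (u ++ v) := by
      intro v
      induction v with
      | nil => intro u x h; simpa using h
      | cons y v ih =>
        intro u x h
        simpa using ih (u ++ [y]) _ (h.step H.retract hκ y)
    have h1 := key w [] (1, [], 1) ⟨1, 1, [], [], rfl, .nil, .nil, by simp⟩
    have h2 := foldl_eq_self H (w.map ψ) (by simpa [Function.comp_def] using h) (1, [], 1)
    rw [List.foldl_map] at h2
    rw [h2] at h1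
    obtain ⟨k, m', u, v, rfl, h3, h4, h5⟩ := h1
    obtain ⟨α, h6, h7, h8⟩ := h3.toN.append h4
    exact ⟨α, ⟨h6, by rw [h7, h5]; simp⟩, h8⟩
  · rintro ⟨α, hα, h⟩
    rw [(prod_eq_of_subst H h).1 hα.1, hα.2]
    simp

/-! ### Removing a simplicial vertex with locally finite neighbours -/

/-- A locally finite group, as a property of a monoid. -/
def Loc (N : Type) [Monoid N] : Prop :=
  (∀ x : N, IsUnit x) ∧ ∀ F : Set N, F.Finite → (Submonoid.closure F : Set N).Finite

lemma Loc.finite_closure_pi {I : Type} [Finite I] {N : I → Type} [∀ i, Monoid (N i)]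
    (h : ∀ i, Loc (N i)) (F : Set (∀ i, (N i)ˣ)) (hF : F.Finite) :
    (Submonoid.closure F : Set (∀ i, (N i)ˣ)).Finite := by
  have h1 : ∀ i, (Submonoid.closure ((fun x => x i) '' F) : Set (N i)ˣ).Finite := by
    intro i
    refine Set.Finite.of_finite_image ?_ (Units.val_injective.injOn (s := _))
    have := (h i).2 (Units.coeHom (N i) '' ((fun x => x i) '' F)) ((hF.image _).image _)
    rw [← MonoidHom.map_mclosure] at this
    exact this
  refine (Set.Finite.pi' h1).subset fun x hx i => ?_
  have : Submonoid.closure F ≤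
      (Submonoid.closure ((fun x => x i) '' F)).comap (Pi.evalMonoidHom (fun i => (N i)ˣ) i) :=
    Submonoid.closure_le.2 fun y hy => Submonoid.subset_closure ⟨y, hy, rfl⟩
  exact this hx

namespace Simplicial

open GraphProduct

variable {V : Type} (G : SimpleGraph V) (M : V → Type) [∀ v, Monoid (M v)] (v : V)

/-- The graph product over the complement of `v`. -/
abbrev Rest : Type :=
  GraphProduct {u : V | u ≠ v} (G.induce {u | u ≠ v}).Adj fun u => M u.1

/-- The product of the unit groups of the neighbours of `v`. -/
abbrev Link : Type := (u : {u // G.Adj v u}) → (M u.1)ˣ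

variable {G v}

variable (v) in
/-- The inclusion of a factor at a vertex different from `v`. -/
def restOf (u : {u : V | u ≠ v}) : M u.1 →* Rest G M v :=
  of (M := fun u : {u : V | u ≠ v} => M u.1) (G.induce {u | u ≠ v}).Adj u

variable {M} in
lemma commute_restOf {u w : {u : V | u ≠ v}} (h : G.Adj u.1 w.1) (a : M u.1) (b : M w.1) :
    Commute (restOf (G := G) M v u a) (restOf M v w b) :=
  commute_of (E := (G.induce {u | u ≠ v}).Adj) (M := fun u : {u : V | u ≠ v} => M u.1)
    (v := u) (w := w) h a b

/-- The inclusion of the unit group of a neighbour. -/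
def unitOf (u : {u // G.Adj v u}) : (M u.1)ˣ →* Rest G M v :=
  (restOf M v ⟨u.1, u.2.ne'⟩).comp (Units.coeHom (M u.1))

lemma unitOf_commute (hc : ∀ u w, G.Adj v u → G.Adj v w → u ≠ w → G.Adj u w) :
    Pairwise fun u w : {u // G.Adj v u} => ∀ x y, Commute (unitOf M u x) (unitOf M w y) :=
  fun u w huw _ _ => commute_restOf (hc u.1 w.1 u.2 w.2 fun h => huw (Subtype.ext h)) _ _

open Classical in
/-- The embedding of the link. -/
noncomputable def link [Fintype V] (hc : ∀ u w, G.Adj v u → G.Adj v w → u ≠ w → G.Adj u w) :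
    Link G M v →* Rest G M v :=
  MonoidHom.noncommPiCoprod (unitOf M) (unitOf_commute M hc)

open Classical in
/-- The retraction onto the link. -/
noncomputable def toLink (hu : ∀ u, G.Adj v u → ∀ x : M u, IsUnit x) :
    Rest G M v →* Link G M v :=
  lift (fun u => if h : G.Adj v u.1 then
      (MonoidHom.mulSingle (fun u : {u // G.Adj v u} => (M u.1)ˣ) ⟨u.1, h⟩).comp
        (IsUnit.liftRight (MonoidHom.id (M u.1)) (hu u.1 h)) else 1) fun u w h a b => by
    split_ifs with h1 h2
    · refine Pi.mulSingle_commute (fun h' => ?_) _ _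
      exact (SimpleGraph.Adj.ne h) (Subtype.ext (Subtype.mk.inj h'))
    all_goals simp

open Classical in
lemma toLink_unitOf (hu : ∀ u, G.Adj v u → ∀ x : M u, IsUnit x) (u : {u // G.Adj v u})
    (x : (M u.1)ˣ) : toLink M hu (unitOf M u x) =
      MonoidHom.mulSingle (fun u : {u // G.Adj v u} => (M u.1)ˣ) u x := by
  simp only [toLink, unitOf, restOf, MonoidHom.comp_apply, lift_of, u.2, dite_true]
  congr 1
  ext
  exact IsUnit.coe_liftRight _ _ _

/-- The inclusion of the graph product over the complement of `v`. -/
def incl : Rest G M v →* GraphProduct V G.Adj M :=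
  lift (fun u => of G.Adj u.1) fun u w h a b =>
    commute_of (E := G.Adj) (v := u.1) (w := w.1) h a b

lemma incl_restOf (u : {u : V | u ≠ v}) (a : M u.1) :
    incl M (restOf M v u a) = of G.Adj u.1 a := lift_of _ _ _ _

lemma commute_link [Fintype V] {Q : Type} [Monoid Q]
    (hc : ∀ u w, G.Adj v u → G.Adj v w → u ≠ w → G.Adj u w) (f' : Rest G M v →* Q) (q : Q)
    (h : ∀ u (x : (M u.1)ˣ), Commute q (f' (unitOf M u x))) (k : Link G M v) :
    Commute q (f' (link M hc k)) := by
  classical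
  have h1 : link M hc k ∈ ⨆ u, MonoidHom.mrange (unitOf (G := G) M u) := by
    rw [← MonoidHom.noncommPiCoprod_mrange (hcomm := unitOf_commute M hc)]
    exact ⟨k, by simp only [link]⟩
  have h2 : ⨆ u, MonoidHom.mrange (unitOf (G := G) M u) ≤ (Submonoid.centralizer {q}).comap f' := by
    refine iSup_le fun u => ?_
    rintro _ ⟨x, rfl⟩
    simpa [Submonoid.mem_centralizer_iff] using (h u x).eq
  simpa [Submonoid.mem_centralizer_iff, commute_iff_eq] using h2 h1

open Classical in
lemma link_mulSingle [Fintype V] (hc : ∀ u w, G.Adj v u → G.Adj v w → u ≠ w → G.Adj u w)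
    (u : {u // G.Adj v u}) (x : (M u.1)ˣ) :
    link M hc (Pi.mulSingle u x) = unitOf M u x := by
  rw [link]
  convert MonoidHom.noncommPiCoprod_mulSingle _ _ _

lemma isAmalgam [Fintype V] (hc : ∀ u w, G.Adj v u → G.Adj v w → u ≠ w → G.Adj u w)
    (hu : ∀ u, G.Adj v u → ∀ x : M u, IsUnit x) :
    IsAmalgam (link M hc) (toLink M hu) (of (M := M) G.Adj v) (incl M) where
  retract k := by
    classical
    have : (toLink M hu).comp (link M hc) = MonoidHom.id _ := by
      refine MonoidHom.pi_ext fun u x => ?_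
      rw [MonoidHom.comp_apply, link_mulSingle, toLink_unitOf]
      rfl
    exact DFunLike.congr_fun this k
  commute a k := by
    refine commute_link M hc _ _ (fun u x => ?_) k
    rw [unitOf, MonoidHom.comp_apply, incl_restOf]
    exact commute_of u.2 _ _
  closure := by
    rw [eq_top_iff, ← closure_of, Submonoid.closure_le]
    rintro _ ⟨u, a, rfl⟩
    refine Submonoid.subset_closure ?_
    by_cases h : u = v
    · subst h
      exact Or.inl ⟨a, rfl⟩
    · exact Or.inr ⟨restOf M v ⟨u, h⟩ a, incl_restOf M _ _⟩
  lift {Q} _ f f' hf := by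
    classical
    have key : ∀ (u : V) (hvu : G.Adj v u) (a : M v) (b : M u),
        Commute (f a) (f' (restOf M v ⟨u, hvu.ne'⟩ b)) := by
      intro u hvu a b
      obtain ⟨x, rfl⟩ := hu u hvu b
      have := hf a (Pi.mulSingle ⟨u, hvu⟩ x)
      rwa [link_mulSingle] at this
    let φ : ∀ u, M u →* Q := fun u => if h : u = v then (by subst h; exact f) else
      f'.comp (restOf M v ⟨u, h⟩)
    have h1 : φ v = f := by simp [φ]
    have h2 : ∀ u (h : u ≠ v), φ u = f'.comp (restOf M v ⟨u, h⟩) := by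
      intro u h
      simp only [φ, h, dite_false]
    have h3 : ∀ u w, G.Adj u w → ∀ a b, Commute (φ u a) (φ w b) := by
      intro u w huw a b
      by_cases hu' : u = v
      · subst hu'
        rw [h1, h2 w huw.ne']
        exact key w huw a b
      · by_cases hw' : w = v
        · subst hw'
          rw [h1, h2 u hu']
          exact (key u huw.symm b a).symm
        · rw [h2 u hu', h2 w hw', MonoidHom.comp_apply, MonoidHom.comp_apply]
          exact (commute_restOf (u := ⟨u, hu'⟩) (w := ⟨w, hw'⟩) huw a b).map f'
    refine ⟨lift φ h3, fun a => by rw [lift_of, h1], fun x => ?_⟩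
    have : (lift φ h3).comp (incl M) = f' := hom_ext fun u a => by
      have := incl_restOf (G := G) M u a
      rw [restOf] at this
      rw [MonoidHom.comp_apply, this, lift_of, h2 u.1 u.2]
      rfl
    exact DFunLike.congr_fun this x

end Simplicial

/-- Adding a simplicial vertex whose neighbours are locally finite groups preserves
context-freeness. -/
theorem CFM.of_simplicial {V : Type} [Fintype V] {G : SimpleGraph V} {M : V → Type}
    [∀ v, Monoid (M v)] {v : V} (hc : ∀ u w, G.Adj v u → G.Adj v w → u ≠ w → G.Adj u w)
    (hloc : ∀ u, G.Adj v u → Loc (M u)) (hv : CFM (M v)) (h : CFM (Simplicial.Rest G M v)) :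
    CFM (GraphProduct V G.Adj M) :=
  .amalgam (Simplicial.isAmalgam M hc fun u hu => (hloc u hu).1) hv h
    (Loc.finite_closure_pi fun u => hloc u.1 u.2)

lemma CFM.of_subsingleton {M : Type} [Monoid M] [Subsingleton M] : CFM M := by
  intro Y _ φ
  let g : BinGrammar Y :=
    { NT := Unit
      finite := inferInstance
      bin := fun _ _ _ => True
      base := fun _ w => w = [] ∨ ∃ y, w = [y]
      base_finite := fun _ => by
        refine ((Set.finite_singleton []).union (Set.finite_range fun y : Y => [y])).subset ?_
        rintro w (h | ⟨y, rfl⟩)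
        · exact Or.inl h
        · exact Or.inr ⟨y, rfl⟩ }
  refine g.cf () fun w => ⟨fun h => ?_, fun _ => Subsingleton.elim _ _⟩
  clear h
  induction w with
  | nil => exact .base (Or.inl rfl)
  | cons y w ih =>
    exact .bin (g := g) (A := ()) (u := [y]) (B := ()) (C := ()) trivial
      (.base (Or.inr ⟨y, rfl⟩)) ih

/-! ### Simplicial vertices of chordal graphs -/

section Dirac

variable {V : Type} {G : SimpleGraph V}

lemma exists_induced_path (hG : G.Connected) (b b' : V) : ∃ (n : ℕ) (p : ℕ → V),
    p 0 = b ∧ p n = b' ∧ (∀ i ≤ n, ∀ j ≤ n, p i = p j → i = j) ∧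
      ∀ i ≤ n, ∀ j ≤ n, (G.Adj (p i) (p j) ↔ j = i + 1 ∨ i = j + 1) := by
  obtain ⟨w, hw⟩ := hG.exists_walk_length_eq_dist b b'
  have hd : ∀ i ≤ w.length, G.dist b (w.getVert i) = i := by
    intro i hi
    have h1 := SimpleGraph.dist_le (w.take i)
    have h2 := SimpleGraph.dist_le (w.drop i)
    have h3 := hG.dist_triangle (u := b) (v := w.getVert i) (w := b')
    simp only [SimpleGraph.Walk.take_length, SimpleGraph.Walk.drop_length] at h1 h2
    omega
  have hinj : ∀ i ≤ w.length, ∀ j ≤ w.length, w.getVert i = w.getVert j → i = j := by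
    intro i hi j hj h
    rw [← hd i hi, h, hd j hj]
  refine ⟨w.length, w.getVert, by simp, by simp, hinj, fun i hi j hj => ⟨fun h => ?_, ?_⟩⟩
  · have h1 := h.diff_dist_adj (u := b)
    rw [hd i hi, hd j hj] at h1
    have hij : i ≠ j := by
      rintro rfl
      exact G.irrefl h
    omega
  · rintro (rfl | rfl)
    · exact w.adj_getVert_succ (by omega)
    · exact (w.adj_getVert_succ (by omega)).symm

/-- The boundary of a connected set disjoint from the neighbourhood of a vertex `w` dominating
it is a clique in a chordal graph. -/
lemma Chordal.adj_of_boundary (h : Chordal V G.Adj) {C : Set V} (hC : (G.induce C).Connected)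
    {w : V} (hw : w ∉ C) (hwC : ∀ c ∈ C, ¬ G.Adj w c) {b b' : V}
    (hb : ∃ c ∈ C, G.Adj b c) (hb' : ∃ c ∈ C, G.Adj b' c) (hwb : G.Adj w b) (hwb' : G.Adj w b')
    (hne : b ≠ b') : G.Adj b b' := by
  by_contra hbb
  obtain ⟨c, hc, hbc⟩ := hb
  obtain ⟨c', hc', hbc'⟩ := hb'
  have hmem : b ∈ C ∪ {b, c} ∪ {b', c'} ∧ b' ∈ C ∪ {b, c} ∪ {b', c'} := by simp
  have hS : (G.induce (C ∪ {b, c} ∪ {b', c'})).Connected :=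
     SimpleGraph.induce_union_connected (SimpleGraph.induce_union_connected hC.preconnected
      (SimpleGraph.induce_pair_connected_of_adj hbc).preconnected
      ⟨c, hc, by simp⟩).preconnected
      (SimpleGraph.induce_pair_connected_of_adj hbc').preconnected ⟨c', Or.inl hc', by simp⟩
  obtain ⟨n, p, h0, hn, hinj, hadj⟩ := exists_induced_path hS ⟨b, hmem.1⟩ ⟨b', hmem.2⟩
  have hn2 : 2 ≤ n := by
    by_contra hlt
    interval_cases n
    · exact hne (congrArg Subtype.val (h0.symm.trans hn))
    · have := (hadj 0 (by omega) 1 (by omega)).2 (by simp)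
      rw [h0, hn] at this
      exact hbb this
  have hpw : ∀ i ≤ n, (p i).1 ≠ w := by
    intro i _ h'
    rcases (p i).2 with (h1 | h1 | h1) | h1 | h1 <;> rw [h'] at h1
    · exact hw h1
    · exact hwb.ne h1
    · exact hw (h1 ▸ hc)
    · exact hwb'.ne h1
    · exact hw ((show w = c' from h1) ▸ hc')
  have hwp : ∀ i ≤ n, (G.Adj w (p i).1 ↔ i = 0 ∨ i = n) := by
    intro i hi
    refine ⟨fun h' => ?_, ?_⟩
    · by_contra hcon
      have h1 : (p i).1 ≠ b := fun h1 => hcon (Or.inl (hinj i hi 0 (by omega)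
        (Subtype.ext (h1.trans (congrArg Subtype.val h0.symm)))))
      have h2 : (p i).1 ≠ b' := fun h1 => hcon (Or.inr (hinj i hi n le_rfl
        (Subtype.ext (h1.trans (congrArg Subtype.val hn.symm)))))
      refine hwC (p i).1 ?_ h'
      rcases (p i).2 with (h3 | h3 | h3) | h3 | h3
      · exact h3
      · exact absurd h3 h1
      · exact Set.mem_of_eq_of_mem h3 hc
      · exact absurd h3 h2
      · exact Set.mem_of_eq_of_mem h3 hc'
    · rintro (rfl | rfl)
      · rwa [h0]
      · rwa [hn]
  have hadj' : ∀ i ≤ n, ∀ j ≤ n, (G.Adj (p i).1 (p j).1 ↔ j = i + 1 ∨ i = j + 1) := hadj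
  have : Fact (1 < n + 2) := ⟨by omega⟩
  let q : ℕ → V := fun i => if i ≤ n then (p i).1 else w
  have hq : ∀ i < n + 2, ∀ j < n + 2, q i = q j → i = j := by
    intro i hi j hj h'
    simp only [q] at h'
    split_ifs at h' with h1 h2 h2
    · exact hinj i h1 j h2 (Subtype.ext h')
    · exact absurd h' (hpw i h1)
    · exact absurd h'.symm (hpw j h2)
    · omega
  have hqa : ∀ i < n + 2, ∀ j < n + 2, (G.Adj (q i) (q j) ↔
      j = (i + 1) % (n + 2) ∨ i = (j + 1) % (n + 2)) := by
    have hmod : ∀ i < n + 2, (i + 1) % (n + 2) = if i = n + 1 then 0 else i + 1 := by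
      intro i hi
      split_ifs with h1
      · subst h1; simp
      · exact Nat.mod_eq_of_lt (by omega)
    intro i hi j hj
    rw [hmod i hi, hmod j hj]
    simp only [q]
    split_ifs <;> first
      | omega
      | (rw [hadj' i (by omega) j (by omega)])
      | (rw [hwp j (by omega)]; omega)
      | (rw [G.adj_comm, hwp i (by omega)]; omega)
      | (simp; omega)
  refine h ⟨n + 2, by omega, fun i => q i.val, fun i j hij => ?_, fun i j => ?_⟩
  · exact ZMod.val_injective _ (hq _ i.val_lt _ j.val_lt hij)
  · rw [hqa _ i.val_lt _ j.val_lt, ← (ZMod.val_injective (n + 2)).eq_iff (a := j),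
      ← (ZMod.val_injective (n + 2)).eq_iff (a := i), ZMod.val_add, ZMod.val_add, ZMod.val_one]

lemma Chordal.induce (h : Chordal V G.Adj) (S : Set V) : Chordal S (G.induce S).Adj := by
  rintro ⟨n, hn, c, hc, hadj⟩
  exact h ⟨n, hn, fun i => (c i).1, Subtype.val_injective.comp hc, fun i j => hadj i j⟩

end Dirac

/-- A finite nonempty chordal graph has a vertex whose neighbours form a clique. -/
theorem Chordal.exists_simplicial (n : ℕ) : ∀ {V : Type} [Fintype V] (G : SimpleGraph V),
    Fintype.card V = n → Nonempty V → Chordal V G.Adj →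
    ∃ v, ∀ u w, G.Adj v u → G.Adj v w → u ≠ w → G.Adj u w := by
  induction n using Nat.strong_induction_on with
  | _ n ih =>
    intro V _ G hn hV h
    classical
    let far (C : Set V) (w : V) : Prop := w ∉ C ∧ ∀ c ∈ C, ¬ G.Adj w c
    by_cases hcomp : ∀ x y : V, x ≠ y → G.Adj x y
    · exact ⟨hV.some, fun u w _ _ huw => hcomp u w huw⟩
    push Not at hcomp
    obtain ⟨x, y, hxy, hadj⟩ := hcomp
    obtain ⟨C, ⟨hC, hfar⟩, hmax⟩ := Set.Finite.exists_maximal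
      (s := {C : Set V | (G.induce C).Connected ∧ ∃ w, far C w}) (Set.toFinite _)
      ⟨{x}, by
        have : (G.induce {x}).Connected := ⟨.of_subsingleton⟩
        refine ⟨this, y, by simpa using hxy.symm, ?_⟩
        rintro c rfl h'
        exact hadj h'.symm⟩
    obtain ⟨w₀, hw₀⟩ := hfar
    have hdom : ∀ b, (∃ c ∈ C, G.Adj b c) → b ∉ C → ∀ w, far C w → G.Adj w b := by
      rintro b ⟨c, hc, hbc⟩ hb w hw
      by_contra hwb
      refine hb (hmax (y := C ∪ {b, c}) ⟨SimpleGraph.induce_union_connected hC.preconnected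
        (SimpleGraph.induce_pair_connected_of_adj hbc).preconnected ⟨c, hc, by simp⟩, w, ?_, ?_⟩
        Set.subset_union_left (by simp))
      · rintro (h1 | rfl | h1)
        · exact hw.1 h1
        · exact hw.2 c hc hbc
        · exact hw.1 ((show w = c from h1) ▸ hc)
      · rintro d (h1 | rfl | h1)
        · exact hw.2 d h1
        · exact hwb
        · exact (show d = c from h1) ▸ hw.2 c hc
    have : Nonempty {w | far C w} := ⟨⟨w₀, hw₀⟩⟩
    obtain ⟨c₀⟩ := hC.nonempty
    obtain ⟨z, hz⟩ := ih (Fintype.card {w | far C w})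
      (hn ▸ Fintype.card_subtype_lt (x := c₀.1) fun h' => h'.1 c₀.2)
      (G.induce {w | far C w}) rfl this (h.induce _)
    have hnb : ∀ u, G.Adj z.1 u → ¬ far C u → (∃ c ∈ C, G.Adj u c) ∧ u ∉ C := by
      intro u hu hfar
      have hu' : u ∉ C := fun h' => z.2.2 u h' hu
      refine ⟨?_, hu'⟩
      by_contra hcon
      push Not at hcon
      exact hfar ⟨hu', hcon⟩
    refine ⟨z.1, fun u w hu hw huw => ?_⟩
    by_cases hu' : far C u <;> by_cases hw' : far C w
    · exact hz ⟨u, hu'⟩ ⟨w, hw'⟩ hu hw fun h' => huw (congrArg Subtype.val h')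
    · obtain ⟨h1, h2⟩ := hnb w hw hw'
      exact hdom w h1 h2 u hu'
    · obtain ⟨h1, h2⟩ := hnb u hu hu'
      exact (hdom u h1 h2 w hw').symm
    · exact h.adj_of_boundary hC z.2.1 z.2.2 (hnb u hu hu').1 (hnb w hw hw').1 hu hw huw

/-! ### Sufficiency -/

/-- Sufficiency when every relevant factor is a locally finite group. -/
theorem cfm_of_chordal (n : ℕ) : ∀ {V : Type} [Fintype V] (G : SimpleGraph V) (M : V → Type)
    [∀ v, Monoid (M v)], Fintype.card V = n → (∀ v, CFM (M v)) →
    (∀ v w, ¬ Loc (M v) → ¬ Loc (M w) → ¬ G.Adj v w) →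
    (∀ v u w, ¬ Loc (M v) → G.Adj v u → G.Adj v w → u ≠ w → G.Adj u w) →
    Chordal V G.Adj → CFM (GraphProduct V G.Adj M) := by
  induction n with
  | zero =>
    intro V _ G M _ hn _ _ _ _
    have : IsEmpty V := Fintype.card_eq_zero_iff.1 hn
    have : Subsingleton (GraphProduct V G.Adj M) := by
      refine ⟨fun x y => ?_⟩
      have h (x : GraphProduct V G.Adj M) : x = 1 := by
        induction x using GraphProduct.induction with
        | one => rfl
        | mul_of x v a ih => exact (IsEmpty.false v).elim
      rw [h x, h y]
    exact .of_subsingleton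
  | succ n ih =>
    intro V _ G M _ hn hM h2 h3 h4
    classical
    obtain ⟨v, hc, hloc⟩ : ∃ v, (∀ u w, G.Adj v u → G.Adj v w → u ≠ w → G.Adj u w) ∧
        ∀ u, G.Adj v u → Loc (M u) := by
      by_cases hall : ∀ v, Loc (M v)
      · obtain ⟨v, hv⟩ := h4.exists_simplicial _ G rfl
          (Fintype.card_pos_iff.1 (hn ▸ Nat.succ_pos n))
        exact ⟨v, hv, fun u _ => hall u⟩
      · push Not at hall
        obtain ⟨v, hv⟩ := hall
        exact ⟨v, fun u w => h3 v u w hv, fun u hu => by_contra fun h => h2 v u hv h hu⟩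
    refine CFM.of_simplicial hc hloc (hM v) ?_
    refine ih _ _ ?_ (fun u => hM u.1) (fun u w hu hw => h2 u.1 w.1 hu hw)
      (fun u w w' hu h h' hne => h3 u.1 w.1 w'.1 hu h h' fun he => hne (Subtype.ext he))
      (h4.induce _)
    have := Fintype.card_subtype_compl (fun u => u = v)
    rw [Fintype.card_subtype_eq, hn, Nat.add_sub_cancel] at this
    rw [← this]
    exact Fintype.card_congr (Equiv.refl _)

section DivisorClosed

open GraphProduct

variable {V : Type} {E : V → V → Prop} {M : V → Type} [∀ v, Monoid (M v)]
  (S : ∀ v, Submonoid (M v))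

open Classical in
/-- The map of a monoid to a divisor-closed submonoid with zero adjoined. -/
noncomputable def toSub {N : Type} [Monoid N] (T : Submonoid N)
    (hT : ∀ a b, a * b ∈ T → a ∈ T ∧ b ∈ T) : N →* WithZero T where
  toFun a := if h : a ∈ T then ((⟨a, h⟩ : T) : WithZero T) else 0
  map_one' := by simp [one_mem]; rfl
  map_mul' a b := by
    by_cases ha : a ∈ T
    · by_cases hb : b ∈ T
      · simp [ha, hb, mul_mem ha hb, ← WithZero.coe_mul]
      · have : a * b ∉ T := fun h => hb (hT _ _ h).2
        simp [hb, this]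
    · have : a * b ∉ T := fun h => ha (hT _ _ h).1
      simp [ha, this]

/-- The inclusion of the graph product of submonoids. -/
def subIncl : GraphProduct V E (fun v => S v) →* GraphProduct V E M :=
  lift (fun v => (of E v).comp (S v).subtype) fun _ _ h _ _ => commute_of h _ _

/-- The map of a graph product to the graph product of divisor-closed submonoids with zero
adjoined. -/
noncomputable def toSubs (hS : ∀ v (a b : M v), a * b ∈ S v → a ∈ S v ∧ b ∈ S v) :
    GraphProduct V E M →* WithZero (GraphProduct V E fun v => S v) :=
  lift (fun v => (WithZero.map' (of (M := fun v => S v) E v)).toMonoidHom.comp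
      (toSub (S v) (hS v))) fun v w h a b => by
    by_cases ha : a ∈ S v
    · by_cases hb : b ∈ S w
      · have := (commute_of (M := fun v => S v) h ⟨a, ha⟩ ⟨b, hb⟩).eq
        simp [toSub, ha, hb, commute_iff_eq, ← WithZero.coe_mul, this]
      · simp [toSub, hb]
    · simp [toSub, ha]

lemma toSubs_subIncl (hS : ∀ v (a b : M v), a * b ∈ S v → a ∈ S v ∧ b ∈ S v)
    (x : GraphProduct V E fun v => S v) : toSubs S hS (subIncl S x) = x := by
  have : (toSubs S hS).comp (subIncl (E := E) S) = WithZero.coeMonoidHom :=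
    hom_ext fun v a => by simp [toSubs, subIncl, toSub]
  exact DFunLike.congr_fun this x

lemma exists_subIncl (hS : ∀ v (a b : M v), a * b ∈ S v → a ∈ S v ∧ b ∈ S v)
    (x : GraphProduct V E M) (hx : toSubs S hS x ≠ 0) : ∃ y, x = subIncl S y := by
  induction x using induction with
  | one => exact ⟨1, by simp⟩
  | mul_of x v a ih =>
    rw [map_mul] at hx
    obtain ⟨y, rfl⟩ := ih (left_ne_zero_of_mul hx)
    by_cases ha : a ∈ S v
    · exact ⟨y * of (M := fun v => S v) E v ⟨a, ha⟩, by simp [subIncl]⟩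
    · exact absurd (by simp [toSubs, toSub, ha]) hx

end DivisorClosed

/-- Context-freeness of a graph product only depends on divisor-closed submonoids of the
factors. -/
theorem CFM.of_divisorClosed {V : Type} {E : V → V → Prop} {M : V → Type} [∀ v, Monoid (M v)]
    (S : ∀ v, Submonoid (M v)) (hS : ∀ v (a b : M v), a * b ∈ S v → a ∈ S v ∧ b ∈ S v)
    (h : CFM (GraphProduct V E fun v => S v)) : CFM (GraphProduct V E M) := by
  intro Y _ φ
  let Y' := {y : Y // ∃ x, φ y = subIncl S x}
  choose ψ hψ using fun y : Y' => y.2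
  refine ((h Y' inferInstance ψ).flatMap fun y => [y.1]).congr fun w => ⟨fun hw => ?_, ?_⟩
  · have h1 : ∀ y ∈ w, ∃ x, φ y = subIncl S x := by
      intro y hy
      refine exists_subIncl S hS _ fun h0 => ?_
      have h2 := congrArg (toSubs S hS) hw
      rw [map_list_prod, map_one, List.prod_eq_zero] at h2
      · exact zero_ne_one h2
      · simpa using ⟨y, hy, h0⟩
    lift w to List Y' using h1
    refine ⟨w, ?_, List.map_eq_flatMap.symm⟩
    have h2 : subIncl S (w.map ψ).prod = 1 := by
      rw [← hw, map_list_prod, List.map_map, List.map_map]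
      exact congrArg List.prod (List.map_congr_left fun y _ => (hψ y).symm)
    have h3 := toSubs_subIncl S hS (w.map ψ).prod
    rw [h2, map_one] at h3
    exact WithZero.coe_injective (h3.symm.trans WithZero.coe_one.symm)
  · rintro ⟨u, hu, rfl⟩
    have h2 := congrArg (subIncl S) hu
    rw [map_list_prod, map_one, List.map_map] at h2
    rw [← h2, ← List.map_eq_flatMap, List.map_map]
    exact congrArg List.prod (List.map_congr_left fun y _ => hψ y)

lemma IsFRI.loc_units {N : Type} [Monoid N] (h : IsFRI N) : Loc (IsUnit.submonoid N) := by
  refine ⟨fun ⟨_, x, hx⟩ => ?_, fun F hF => ?_⟩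
  · subst hx
    exact ⟨⟨⟨x, x.isUnit⟩, ⟨(x⁻¹ : Nˣ), Units.isUnit _⟩, Subtype.ext x.mul_inv,
      Subtype.ext x.inv_mul⟩, rfl⟩
  · refine Set.Finite.of_finite_image (f := Subtype.val) ?_ Subtype.val_injective.injOn
    have h1 := h.finite_closure (hF.image (IsUnit.submonoid N).subtype) (by
      rintro _ ⟨x, _, rfl⟩
      exact x.2)
    rw [← MonoidHom.map_mclosure] at h1
    exact h1

/-- The conditions on factors and graph suffice for context-freeness. -/
theorem sufficiency {V : Type} [Fintype V] (G : SimpleGraph V) (M : V → Type)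
    [∀ v, Monoid (M v)] (h1 : ∀ v, CFM (M v))
    (h2 : ∀ v w, ¬ IsFRI (M v) → ¬ IsFRI (M w) → v ≠ w → ¬ G.Adj v w)
    (h3 : ∀ u v w, ¬ IsFRI (M v) → IsFRI (M u) → IsFRI (M w) → G.Adj v u → G.Adj v w → u ≠ w →
      G.Adj u w) (h4 : Chordal V G.Adj) : CFM (GraphProduct V G.Adj M) := by
  classical
  let S : ∀ v, Submonoid (M v) := fun v => if IsFRI (M v) then IsUnit.submonoid (M v) else ⊤
  have hloc : ∀ v, IsFRI (M v) → Loc (S v) := by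
    intro v hv
    have hSv : S v = IsUnit.submonoid (M v) := if_pos hv
    rw [hSv]
    exact hv.loc_units
  have hfri : ∀ v, ¬ Loc (S v) → ¬ IsFRI (M v) := fun v h h' => h (hloc v h')
  refine CFM.of_divisorClosed S (fun v a b hab => ?_) ?_
  · by_cases hv : IsFRI (M v)
    · simp only [S, hv, if_true, IsUnit.mem_submonoid_iff] at hab ⊢
      obtain ⟨c, hc⟩ := hab.exists_right_inv
      obtain ⟨d, hd⟩ := hab.exists_left_inv
      rw [mul_assoc] at hc
      rw [← mul_assoc] at hd
      exact ⟨(hv.isUnit_of_mul_eq_one hc).1, (hv.isUnit_of_mul_eq_one hd).2⟩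
    · simp [S, hv]
  · refine cfm_of_chordal _ G _ rfl (fun v => (h1 v).of_injective _ (S v).subtype_injective)
      (fun v w hv hw h => h2 v w (hfri v hv) (hfri w hw) h.ne h) (fun v u w hv hu hw hne => ?_) h4
    have hfri' : ∀ u, G.Adj v u → IsFRI (M u) :=
      fun u hu => by_contra fun h => h2 v u (hfri v hv) h hu.ne hu
    exact h3 u v w (hfri v hv) (hfri' u hu) (hfri' w hw) hu hw hne

/-- Characterization of the context-free graph products: for a finite
simple graph `Γ = (V, E)` and monoids `M v` with `J(M v) ≠ {1}`, the graph product is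
context-free iff (1) every factor is context-free, (2) no two distinct non-FRI factors
are adjacent, (3) the FRI neighbors of any non-FRI vertex are pairwise adjacent,
and (4) `Γ` is chordal. -/
theorem stmt9 (V : Type) [Fintype V] (E : V → V → Prop)
    (hsymm : Symmetric E) (hirr : Irreflexive E)
    (M : V → Type) [∀ v, Monoid (M v)]
    (hJ : ∀ v, ∃ a : M v, a ≠ 1 ∧ a ∈ Jset (M v)) :
    MonoidContextFree (GraphProduct V E M) ↔
      ((∀ v, MonoidContextFree (M v)) ∧
       (∀ v w, ¬ IsFRI (M v) → ¬ IsFRI (M w) → v ≠ w → ¬ E v w) ∧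
       (∀ u v w, ¬ IsFRI (M v) → IsFRI (M u) → IsFRI (M w) →
          E v u → E v w → u ≠ w → E u w) ∧
       Chordal V E) := by
  obtain ⟨G, rfl⟩ : ∃ G : SimpleGraph V, G.Adj = E := ⟨⟨E, ⟨hsymm⟩, ⟨hirr⟩⟩, rfl⟩
  simp only [monoidContextFree_iff]
  exact ⟨necessity G M hJ, fun ⟨h1, h2, h3, h4⟩ => sufficiency G M h1 h2 h3 h4⟩

end Paper
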